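/- Let g be an increasing, differentiable function diverging to ∞ such that g'(c) = O(g(Q)^{0.99}·Q^{-0.01}) uniformly for c ∈ [Q, Q+Q^{0.01}] as Q → ∞, and g(Q) ≪_ε Q^ε for every ε > 0. For each prime q choose a positive integer h_q such that h_q → ∞ and (log h_q)/(log g(q)) → 0 as q → ∞ through primes. Then there exists a set B of primes which is η-sufficient for every η ∈ [0.01, 1], such that for every λ ∈ ℝ, M_{g,q,h_q}(λ) converges to (1/√(2π))·∫_{-∞}^{λ} e^{-t²/2} dt as q → ∞ along q ∈ B. -/

import Mathlib

open Filter Topology MeasureTheory Asymptotics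
open scoped Classical

noncomputable section

/-- `S h x q = ∑_{x < n ≤ x + h} (n/q)`, where `(n/q)` is the Legendre symbol
(realized by the Jacobi symbol, which agrees with it for prime `q`). -/
def S (h : ℕ) (x : ℝ) (q : ℕ) : ℤ :=
  ∑ j ∈ Finset.Icc 1 h, jacobiSym (⌊x⌋ + j) q

/-- `M g q h λ = (1/g(q)) · #{m ∈ ℤ : 1 ≤ m ≤ g(q), S_h(m,q) ≤ λ√h}`. -/
def M (g : ℝ → ℝ) (q h : ℕ) (lam : ℝ) : ℝ :=
  (1 / g q) *
    ({m : ℤ | 1 ≤ (m : ℝ) ∧ (m : ℝ) ≤ g q ∧ (S h (m : ℝ) q : ℝ) ≤ lam * Real.sqrt h}).ncard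

/-- The standard Gaussian cumulative distribution function. -/
def gaussLimit (lam : ℝ) : ℝ :=
  (1 / Real.sqrt (2 * Real.pi)) * ∫ t in Set.Iic lam, Real.exp (-t ^ 2 / 2)

/-- A set of primes `B` is `η`-sufficient if
`|(P \ B) ∩ [X, X + X^η]| = o(X^η / log X)` as `X → ∞`. -/
def EtaSufficient (η : ℝ) (B : Set ℕ) : Prop :=
  (fun X : ℝ =>
      (({p : ℕ | p.Prime ∧ p ∉ B ∧ X ≤ p ∧ (p : ℝ) ≤ X + X ^ η}).ncard : ℝ))
    =o[atTop] fun X : ℝ => X ^ η / Real.log X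

theorem sum_moebius_between {D l m : ℕ} (hm : m ∈ Finset.Icc 1 D) (hl : 1 ≤ l) :
    ∑ d ∈ Finset.Icc 1 D, (if l ∣ d ∧ d ∣ m then (ArithmeticFunction.moebius (m / d) : ℝ) else 0)
      = if m = l then 1 else 0 := by
  have hm1 := (Finset.mem_Icc.1 hm)
  rw [← Finset.sum_filter]
  by_cases hlm : l ∣ m
  · obtain ⟨k, rfl⟩ := hlm
    have hk : 0 < k := by
      rcases Nat.eq_zero_or_pos k with rfl | h
      · simp at hm1
      · exact h
    have h1 : ∑ e ∈ k.divisors, (ArithmeticFunction.moebius e : ℝ) = if k = 1 then 1 else 0 := by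
      have := ArithmeticFunction.coe_zeta_mul_apply
        (f := (ArithmeticFunction.moebius : ArithmeticFunction ℤ)) (x := k)
      rw [ArithmeticFunction.coe_zeta_mul_moebius, ArithmeticFunction.one_apply] at this
      exact_mod_cast this.symm
    have h2 : (l * k = l) ↔ k = 1 := by
      constructor
      · intro h
        exact Nat.eq_of_mul_eq_mul_left hl (by simpa using h)
      · rintro rfl; simp
    simp only [h2]
    rw [← h1]
    refine Finset.sum_bij' (fun d _ => l * k / d) (fun e _ => l * (k / e)) ?_ ?_ ?_ ?_ ?_
    · intro d hd
      obtain ⟨hd1, ⟨a, rfl⟩, hd2⟩ := Finset.mem_filter.1 hd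
      have ha : a ∣ k := Nat.dvd_of_mul_dvd_mul_left hl hd2
      rw [Nat.mul_div_mul_left _ _ hl, Nat.mem_divisors]
      exact ⟨Nat.div_dvd_of_dvd ha, hk.ne'⟩
    · intro e he
      have he' := Nat.dvd_of_mem_divisors he
      have hdvd : k / e ∣ k := Nat.div_dvd_of_dvd he'
      have hpos : 0 < k / e := Nat.pos_of_dvd_of_pos hdvd hk
      refine Finset.mem_filter.2 ⟨Finset.mem_Icc.2 ⟨Nat.mul_pos hl hpos, ?_⟩,
        dvd_mul_right _ _, Nat.mul_dvd_mul_left _ hdvd⟩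
      exact le_trans (Nat.mul_le_mul_left _ (Nat.le_of_dvd hk hdvd)) hm1.2
    · intro d hd
      obtain ⟨hd1, ⟨a, rfl⟩, hd2⟩ := Finset.mem_filter.1 hd
      have ha : a ∣ k := Nat.dvd_of_mul_dvd_mul_left hl hd2
      simp only [Nat.mul_div_mul_left _ _ hl]
      rw [Nat.div_div_self ha hk.ne']
    · intro e he
      have he' := Nat.dvd_of_mem_divisors he
      simp only [Nat.mul_div_mul_left _ _ hl]
      rw [Nat.div_div_self he' hk.ne']
    · intro d hd
      rfl
  · rw [if_neg (by rintro rfl; exact hlm dvd_rfl), Finset.sum_eq_zero]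
    intro d hd
    obtain ⟨-, h1, h2⟩ := Finset.mem_filter.1 hd
    exact absurd (h1.trans h2) hlm

/-- The normalising sum `∑_{l ≤ D} μ(l)² / φ(l)` of the Selberg sieve. -/
def selbergMass (D : ℕ) : ℝ :=
  ∑ l ∈ Finset.Icc 1 D, (ArithmeticFunction.moebius l : ℝ) ^ 2 / (l.totient : ℝ)

theorem sum_inv_sq_le_two (D : ℕ) : ∑ a ∈ Finset.Icc 1 D, (1 : ℝ) / (a : ℝ) ^ 2 ≤ 2 := by
  have key : ∀ n : ℕ, ∑ a ∈ Finset.Icc 1 (n + 1), (1 : ℝ) / (a : ℝ) ^ 2 ≤ 2 - 1 / ((n : ℝ) + 1) := by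
    intro n
    induction n with
    | zero => norm_num
    | succ n ih =>
      rw [Finset.sum_Icc_succ_top (by omega)]
      have : (1 : ℝ) / (((n + 1 + 1 : ℕ) : ℝ)) ^ 2 ≤ 1 / ((n : ℝ) + 1) - 1 / ((n : ℝ) + 1 + 1) := by
        push_cast
        rw [div_sub_div _ _ (by positivity) (by positivity), div_le_div_iff₀ (by positivity) (by positivity)]
        nlinarith [(n.cast_nonneg : (0 : ℝ) ≤ n)]
      push_cast at *
      linarith
  rcases D with _ | n
  · simp
  · refine (key n).trans ?_
    have : (0 : ℝ) ≤ 1 / ((n : ℝ) + 1) := by positivity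
    linarith

theorem half_log_le_selbergMass (D : ℕ) : Real.log D / 2 ≤ selbergMass D := by
  have h1 : Real.log D ≤ ∑ n ∈ Finset.Icc 1 D, (1 : ℝ) / n := by
    rcases Nat.eq_zero_or_pos D with rfl | hD
    · simp
    have := log_add_one_le_harmonic D
    rw [harmonic_eq_sum_Icc] at this
    push_cast at this
    simp only [one_div]
    refine le_trans (Real.log_le_log (by exact_mod_cast hD) (by simp)) this
  have h2 : ∑ n ∈ Finset.Icc 1 D, (1 : ℝ) / n ≤
      ∑ x ∈ (Finset.Icc 1 D).filter Squarefree ×ˢ Finset.Icc 1 D, (1 : ℝ) / (x.1 * (x.2 : ℝ) ^ 2) := by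
    have hex : ∀ n : ℕ, ∃ x : ℕ × ℕ, 1 ≤ n → Squarefree x.1 ∧ x.1 * x.2 ^ 2 = n := by
      intro n
      obtain ⟨a, b, hab, hsq⟩ := Nat.sq_mul_squarefree n
      exact ⟨(a, b), fun _ => ⟨hsq, by rw [mul_comm]; exact hab⟩⟩
    choose f hf using hex
    have hinj : Set.InjOn f (Finset.Icc 1 D : Finset ℕ) := by
      intro a ha b hb hab
      have ha' := hf a (Finset.mem_Icc.1 ha).1
      have hb' := hf b (Finset.mem_Icc.1 hb).1
      rw [← ha'.2, ← hb'.2, hab]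
    calc ∑ n ∈ Finset.Icc 1 D, (1 : ℝ) / n
        = ∑ n ∈ Finset.Icc 1 D, (1 : ℝ) / ((f n).1 * ((f n).2 : ℝ) ^ 2) := by
          refine Finset.sum_congr rfl fun n hn => ?_
          have := (hf n (Finset.mem_Icc.1 hn).1).2
          conv_lhs => rw [← this]
          push_cast
          rfl
      _ = ∑ x ∈ (Finset.Icc 1 D).image f, (1 : ℝ) / (x.1 * (x.2 : ℝ) ^ 2) := by
          rw [Finset.sum_image hinj]
      _ ≤ _ := by
          refine Finset.sum_le_sum_of_subset_of_nonneg ?_ (fun _ _ _ => by positivity)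
          intro x hx
          obtain ⟨n, hn, rfl⟩ := Finset.mem_image.1 hx
          obtain ⟨hn1, hn2⟩ := Finset.mem_Icc.1 hn
          obtain ⟨hs, he⟩ := hf n hn1
          have hb : 0 < (f n).2 := by
            rcases Nat.eq_zero_or_pos (f n).2 with h | h
            · rw [h] at he; simp at he; omega
            · exact h
          have ha : 0 < (f n).1 := Nat.pos_of_ne_zero hs.ne_zero
          simp only [Finset.mem_product, Finset.mem_filter, Finset.mem_Icc]
          refine ⟨⟨⟨ha, ?_⟩, hs⟩, hb, ?_⟩
          · nlinarith [Nat.pow_pos hb (n := 2)]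
          · nlinarith [Nat.pow_pos hb (n := 2)]
  have h3 : ∑ l ∈ (Finset.Icc 1 D).filter Squarefree, (1 : ℝ) / l ≤ selbergMass D := by
    rw [selbergMass, Finset.sum_filter]
    refine Finset.sum_le_sum fun l hl => ?_
    have hl1 := (Finset.mem_Icc.1 hl).1
    have hphi : (0 : ℝ) < l.totient := by exact_mod_cast Nat.totient_pos.2 hl1
    split_ifs with hs
    · have : (ArithmeticFunction.moebius l : ℝ) ^ 2 = 1 := by
        have := ArithmeticFunction.moebius_sq_eq_one_of_squarefree hs
        exact_mod_cast this
      rw [this]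
      exact one_div_le_one_div_of_le hphi (by exact_mod_cast Nat.totient_le l)
    · positivity
  have h4 : ∑ x ∈ (Finset.Icc 1 D).filter Squarefree ×ˢ Finset.Icc 1 D, (1 : ℝ) / (x.1 * (x.2 : ℝ) ^ 2)
      = (∑ l ∈ (Finset.Icc 1 D).filter Squarefree, (1 : ℝ) / l) * ∑ a ∈ Finset.Icc 1 D, (1 : ℝ) / (a : ℝ) ^ 2 := by
    rw [Finset.sum_product, Finset.sum_mul_sum]
    refine Finset.sum_congr rfl fun _ _ => Finset.sum_congr rfl fun _ _ => ?_
    field_simp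
  have h5 := sum_inv_sq_le_two D
  have h6 : 0 ≤ ∑ l ∈ (Finset.Icc 1 D).filter Squarefree, (1 : ℝ) / l := by positivity
  rw [h4] at h2
  nlinarith

/-- Optimal weights of the Selberg sieve of level `D`. -/
theorem exists_selberg_weights {D : ℕ} (hD : 2 ≤ D) :
    ∃ w : ℕ → ℝ, w 1 = 1 ∧ (∀ d ∈ Finset.Icc 1 D, |w d| ≤ (D : ℝ) ^ 2) ∧
      ∑ a ∈ Finset.Icc 1 D, ∑ b ∈ Finset.Icc 1 D, w a * w b / (Nat.lcm a b : ℝ)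
        ≤ 2 / Real.log D := by
  set V := selbergMass D with hV
  have hlog : 0 < Real.log D := Real.log_pos (by exact_mod_cast hD)
  have hV1 : 1 ≤ V := by
    rw [hV, selbergMass]
    have : (1 : ℝ) = (ArithmeticFunction.moebius 1 : ℝ) ^ 2 / (Nat.totient 1 : ℝ) := by simp
    rw [this]
    exact Finset.single_le_sum (f := fun l : ℕ => (ArithmeticFunction.moebius l : ℝ) ^ 2 / (l.totient : ℝ))
      (fun _ _ => by positivity) (Finset.mem_Icc.2 ⟨le_rfl, by omega⟩)
  set y : ℕ → ℝ := fun l => (ArithmeticFunction.moebius l : ℝ) / (l.totient * V) with hy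
  have hyle : ∀ l, 1 ≤ l → |y l| ≤ 1 := by
    intro l hl
    have hphi : (1 : ℝ) ≤ l.totient := by exact_mod_cast Nat.totient_pos.2 hl
    have h1 : |(ArithmeticFunction.moebius l : ℝ)| ≤ 1 := by
      exact_mod_cast ArithmeticFunction.abs_moebius_le_one (n := l)
    simp only [hy]
    rw [abs_div, abs_of_pos (show (0 : ℝ) < l.totient * V by positivity), div_le_one (by positivity)]
    nlinarith
  set w : ℕ → ℝ := fun d => d * ∑ m ∈ Finset.Icc 1 D,
    if d ∣ m then (ArithmeticFunction.moebius (m / d) : ℝ) * y m else 0 with hw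
  have hinv : ∀ l ∈ Finset.Icc 1 D,
      ∑ d ∈ Finset.Icc 1 D, (if l ∣ d then w d / d else 0) = y l := by
    intro l hl
    calc ∑ d ∈ Finset.Icc 1 D, (if l ∣ d then w d / d else 0)
        = ∑ d ∈ Finset.Icc 1 D, ∑ m ∈ Finset.Icc 1 D,
          (if l ∣ d ∧ d ∣ m then (ArithmeticFunction.moebius (m / d) : ℝ) else 0) * y m := by
          refine Finset.sum_congr rfl fun d hd => ?_
          have hd0 : (d : ℝ) ≠ 0 := by
            have := (Finset.mem_Icc.1 hd).1
            positivity
          by_cases h : l ∣ d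
          · simp only [h, if_true, hw, true_and]
            rw [mul_div_cancel_left₀ _ hd0]
            refine Finset.sum_congr rfl fun m _ => ?_
            split_ifs <;> simp
          · simp [h]
      _ = ∑ m ∈ Finset.Icc 1 D, (if m = l then 1 else 0) * y m := by
          rw [Finset.sum_comm]
          refine Finset.sum_congr rfl fun m hm => ?_
          rw [← Finset.sum_mul, sum_moebius_between hm (Finset.mem_Icc.1 hl).1]
      _ = y l := by
          simp only [ite_mul, one_mul, zero_mul, Finset.sum_ite_eq', hl, if_true]
  refine ⟨w, ?_, ?_, ?_⟩
  · simp only [hw, hy, one_dvd, if_true, Nat.div_one, Nat.cast_one, one_mul]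
    have : ∀ m : ℕ, (ArithmeticFunction.moebius m : ℝ) * ((ArithmeticFunction.moebius m : ℝ) / (m.totient * V))
        = (ArithmeticFunction.moebius m : ℝ) ^ 2 / m.totient / V := by
      intro m
      rw [div_div, sq, mul_div_assoc]
    simp only [this]
    rw [← Finset.sum_div]
    exact div_self (by positivity)
  · intro d hd
    obtain ⟨hd1, hd2⟩ := Finset.mem_Icc.1 hd
    have hdD : (d : ℝ) ≤ D := by exact_mod_cast hd2
    simp only [hw]
    rw [abs_mul, sq, Nat.abs_cast]
    refine mul_le_mul hdD ?_ (abs_nonneg _) (by positivity)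
    refine (Finset.abs_sum_le_sum_abs _ _).trans ?_
    have : ∀ m ∈ Finset.Icc 1 D, |if d ∣ m then (ArithmeticFunction.moebius (m / d) : ℝ) * y m else 0| ≤ 1 := by
      intro m hm
      split_ifs
      · have h1 : |(ArithmeticFunction.moebius (m / d) : ℝ)| ≤ 1 := by
          exact_mod_cast ArithmeticFunction.abs_moebius_le_one (n := m / d)
        rw [abs_mul]
        exact mul_le_one₀ h1 (abs_nonneg _) (hyle m (Finset.mem_Icc.1 hm).1)
      · simp
    refine (Finset.sum_le_sum this).trans ?_
    simp
  · have hgcd : ∀ a ∈ Finset.Icc 1 D, ∀ b ∈ Finset.Icc 1 D, w a * w b / (Nat.lcm a b : ℝ)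
        = ∑ l ∈ Finset.Icc 1 D, (l.totient : ℝ) *
          ((if l ∣ a then w a / a else 0) * (if l ∣ b then w b / b else 0)) := by
      intro a ha b hb
      obtain ⟨ha1, ha2⟩ := Finset.mem_Icc.1 ha
      obtain ⟨hb1, hb2⟩ := Finset.mem_Icc.1 hb
      have hlcm : (Nat.gcd a b : ℝ) * (Nat.lcm a b : ℝ) = a * b := by exact_mod_cast Nat.gcd_mul_lcm a b
      have hl0 : (Nat.lcm a b : ℝ) ≠ 0 := by
        have := Nat.lcm_ne_zero (show a ≠ 0 by omega) (show b ≠ 0 by omega)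
        exact_mod_cast this
      have hg0 : 0 < Nat.gcd a b := Nat.gcd_pos_of_pos_left _ ha1
      have ha0 : (a : ℝ) ≠ 0 := by positivity
      have hb0 : (b : ℝ) ≠ 0 := by positivity
      have h1 : w a * w b / (Nat.lcm a b : ℝ) = (Nat.gcd a b : ℝ) * (w a / a * (w b / b)) := by
        field_simp
        linear_combination (-(w a * w b)) * hlcm
      rw [h1]
      have h2 : (Nat.gcd a b : ℝ) = ∑ l ∈ (Finset.Icc 1 D).filter (fun l => l ∣ a ∧ l ∣ b), (l.totient : ℝ) := by
        have h3 := Nat.sum_totient (Nat.gcd a b)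
        have h4 : (Finset.Icc 1 D).filter (fun l => l ∣ a ∧ l ∣ b) = (Nat.gcd a b).divisors := by
          ext l
          simp only [Finset.mem_filter, Finset.mem_Icc, Nat.mem_divisors, Nat.dvd_gcd_iff]
          constructor
          · rintro ⟨-, h⟩; exact ⟨h, hg0.ne'⟩
          · rintro ⟨h, -⟩
            exact ⟨⟨Nat.pos_of_dvd_of_pos h.1 ha1, (Nat.le_of_dvd ha1 h.1).trans ha2⟩, h⟩
        rw [h4]
        exact_mod_cast h3.symm
      rw [h2, Finset.sum_mul, Finset.sum_filter]
      refine Finset.sum_congr rfl fun l _ => ?_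
      by_cases h5 : l ∣ a <;> by_cases h6 : l ∣ b <;> simp [h5, h6]
    have hQ : ∑ a ∈ Finset.Icc 1 D, ∑ b ∈ Finset.Icc 1 D, w a * w b / (Nat.lcm a b : ℝ)
        = ∑ l ∈ Finset.Icc 1 D, (l.totient : ℝ) * (y l) ^ 2 := by
      rw [Finset.sum_congr rfl fun a ha => Finset.sum_congr rfl fun b hb => hgcd a ha b hb]
      rw [Finset.sum_congr rfl fun a _ => Finset.sum_comm, Finset.sum_comm]
      refine Finset.sum_congr rfl fun l hl => ?_
      rw [← hinv l hl, sq, Finset.sum_mul_sum, Finset.mul_sum]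
      refine Finset.sum_congr rfl fun a _ => ?_
      rw [Finset.mul_sum]
    rw [hQ]
    have h7 : ∑ l ∈ Finset.Icc 1 D, (l.totient : ℝ) * (y l) ^ 2 = 1 / V := by
      have : ∀ l ∈ Finset.Icc 1 D, (l.totient : ℝ) * (y l) ^ 2
          = (ArithmeticFunction.moebius l : ℝ) ^ 2 / (l.totient : ℝ) * (1 / V ^ 2) := by
        intro l hl
        have hphi : (0 : ℝ) < l.totient := by exact_mod_cast Nat.totient_pos.2 (Finset.mem_Icc.1 hl).1
        simp only [hy]
        field_simp
      rw [Finset.sum_congr rfl this, ← Finset.sum_mul]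
      change V * (1 / V ^ 2) = 1 / V
      field_simp
    rw [h7]
    have h8 := half_log_le_selbergMass D
    rw [div_le_div_iff₀ (by positivity) hlog]
    linarith
theorem exists_jacobiSym_eq_neg_one {N : ℕ} (hN : ¬ IsSquare N) :
    ∃ n : ℕ, Odd n ∧ jacobiSym N n = -1 := by
  obtain ⟨s, t, hst, hs⟩ := Nat.sq_mul_squarefree N
  have hN0 : N ≠ 0 := by rintro rfl; exact hN ⟨0, rfl⟩
  have ht0 : t ≠ 0 := by rintro rfl; simp at hst; exact hN0 hst.symm
  have hs1 : s ≠ 1 := by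
    rintro rfl
    exact hN ⟨t, by rw [← hst]; ring⟩
  have key : ∀ n : ℕ, Nat.Coprime t n → jacobiSym N n = jacobiSym s n := by
    intro n hn
    rw [← hst]
    push_cast
    rw [jacobiSym.mul_left, jacobiSym.sq_one' (by simpa using hn), one_mul]
  by_cases hodd : ∃ p, p.Prime ∧ p ∣ s ∧ p ≠ 2
  · obtain ⟨p, hp, ⟨u, rfl⟩, hp2⟩ := hodd
    have : Fact p.Prime := ⟨hp⟩
    have hpu : Nat.Coprime p u := Nat.coprime_of_squarefree_mul hs
    have hu0 : u ≠ 0 := by rintro rfl; simp at hs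
    obtain ⟨e, T, hT, hut⟩ := Nat.exists_eq_pow_mul_and_not_dvd (mul_ne_zero hu0 ht0) p hp.ne_one
    have hpT : Nat.Coprime p T := (Nat.Prime.coprime_iff_not_dvd hp).2 hT
    have hp8 : Nat.Coprime p 8 := by
      have := (Nat.coprime_primes hp Nat.prime_two).2 hp2
      exact this.pow_right 3
    obtain ⟨c, hc⟩ := FiniteField.exists_nonsquare (F := ZMod p) (by rw [ZMod.ringChar_zmod_n]; exact hp2)
    obtain ⟨n, hn1, hn2⟩ := Nat.chineseRemainder (hp8.mul_right hpT).symm 1 c.val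
    have hn4 : n ≡ 1 [MOD 4] := hn1.of_dvd ⟨2 * T, by ring⟩
    have hnodd : Odd n := by
      rw [Nat.odd_iff]
      exact hn4.of_dvd (by norm_num)
    have hnc : ((n : ℤ) : ZMod p) = c := by
      have := (ZMod.natCast_eq_natCast_iff _ _ _).2 hn2
      rw [ZMod.natCast_zmod_val] at this
      simpa using this
    have hlp : jacobiSym n p = -1 := by
      rw [← jacobiSym.legendreSym.to_jacobiSym, legendreSym.eq_neg_one_iff, hnc]
      exact hc
    have hnp : Nat.Coprime p n := by
      rw [Nat.Prime.coprime_iff_not_dvd hp]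
      intro hdvd
      have h0 : ((n : ℤ) : ZMod p) = 0 := by
        have := (ZMod.natCast_eq_zero_iff n p).2 hdvd
        simpa using this
      rw [h0] at hnc
      exact hc ⟨0, by rw [← hnc]; simp⟩
    have hnT : Nat.Coprime T n := by
      have : n ≡ 1 [MOD T] := hn1.of_dvd ⟨8, by ring⟩
      have := this.gcd_eq
      rw [Nat.gcd_one_left] at this
      rwa [Nat.Coprime, Nat.gcd_comm]
    have hutn : Nat.Coprime (u * t) n := by
      rw [hut]
      exact Nat.Coprime.mul_left (hnp.pow_left _) hnT
    refine ⟨n, hnodd, ?_⟩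
    rw [key n (hutn.coprime_dvd_left (dvd_mul_left _ _))]
    push_cast
    rw [jacobiSym.mul_left]
    have h1 : jacobiSym p n = -1 := by
      rw [jacobiSym.quadratic_reciprocity_one_mod_four' (hp.odd_of_ne_two hp2) hn4, hlp]
    have h2 : jacobiSym u n = 1 := by
      have hudvd : u ∣ T := by
        have : u ∣ p ^ e * T := by rw [← hut]; exact dvd_mul_right _ _
        exact (hpu.symm.pow_right e).dvd_of_dvd_mul_left this
      have : n % (4 * u) = 1 % (4 * u) := by
        refine hn1.of_dvd ?_
        obtain ⟨k, rfl⟩ := hudvd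
        exact ⟨2 * k, by ring⟩
      rw [jacobiSym.mod_right' u hnodd, this, Nat.mod_eq_of_lt (by omega), jacobiSym.one_right]
    rw [h1, h2]; norm_num
  · push Not at hodd
    have hs2 : s = 2 := by
      obtain ⟨p, hp, hps⟩ := Nat.exists_prime_and_dvd hs1
      have hp2 := hodd p hp hps
      subst hp2
      obtain ⟨u, rfl⟩ := hps
      by_contra hne
      have hu1 : u ≠ 1 := by rintro rfl; simp at hne
      obtain ⟨r, hr, hru⟩ := Nat.exists_prime_and_dvd hu1
      have hr2 := hodd r hr (hru.mul_left _)
      subst hr2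
      have := Nat.coprime_of_squarefree_mul hs
      exact absurd (Nat.eq_one_of_dvd_coprimes this dvd_rfl hru) (by norm_num)
    subst hs2
    obtain ⟨e, T, hT, hut⟩ := Nat.exists_eq_pow_mul_and_not_dvd ht0 2 (by norm_num)
    have h2T : Nat.Coprime 2 T := (Nat.Prime.coprime_iff_not_dvd Nat.prime_two).2 hT
    obtain ⟨n, hn1, hn2⟩ := Nat.chineseRemainder (h2T.pow_left 3) 5 1
    have hn8 : n % 8 = 5 := hn1
    have hnodd : Odd n := by rw [Nat.odd_iff]; omega
    have hnT : Nat.Coprime T n := by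
      have := hn2.gcd_eq
      rw [Nat.gcd_one_left] at this
      rwa [Nat.Coprime, Nat.gcd_comm]
    have hn2' : Nat.Coprime 2 n := (Nat.coprime_two_left).2 hnodd
    refine ⟨n, hnodd, ?_⟩
    rw [key n (by rw [hut]; exact Nat.Coprime.mul_left (hn2'.pow_left _) hnT)]
    rw [Nat.cast_ofNat, jacobiSym.at_two hnodd, ZMod.χ₈_nat_eq_if_mod_eight]
    simp [hn8]
    omega

/-- The quadratic symbol `n ↦ (N/n)`, set to zero at even `n`. -/
def oddJacobi (N n : ℕ) : ℤ := if Odd n then jacobiSym N n else 0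

theorem abs_oddJacobi_le_one (N n : ℕ) : |oddJacobi N n| ≤ 1 := by
  unfold oddJacobi
  split_ifs
  · rcases jacobiSym.trichotomy N n with h | h | h <;> simp [h]
  · simp

theorem oddJacobi_mul (N a b : ℕ) : oddJacobi N (a * b) = oddJacobi N a * oddJacobi N b := by
  unfold oddJacobi
  by_cases ha : Odd a <;> by_cases hb : Odd b <;> simp [ha, hb, Nat.odd_mul]
  rw [jacobiSym.mul_right' _ ha.pos.ne' hb.pos.ne']

theorem oddJacobi_periodic (N : ℕ) : Function.Periodic (oddJacobi N) (4 * N) := by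
  intro n
  have h : Odd (n + 4 * N) ↔ Odd n := by
    rw [Nat.odd_add]
    have : Even (4 * N) := ⟨2 * N, by ring⟩
    simp [this]
  unfold oddJacobi
  by_cases hn : Odd n
  · rw [if_pos (h.2 hn), if_pos hn, jacobiSym.mod_right' N (h.2 hn), jacobiSym.mod_right' N hn]
    simp
  · rw [if_neg (fun h' => hn (h.1 h')), if_neg hn]

theorem sum_oddJacobi_period {N : ℕ} (hN : ¬ IsSquare N) :
    ∑ n ∈ Finset.range (4 * N), oddJacobi N n = 0 := by
  have hN0 : N ≠ 0 := by rintro rfl; exact hN ⟨0, rfl⟩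
  have : NeZero (4 * N) := ⟨by omega⟩
  obtain ⟨n₀, hodd, hn₀⟩ := exists_jacobiSym_eq_neg_one hN
  have hcop : Nat.Coprime n₀ (4 * N) := by
    refine Nat.Coprime.mul_right ?_ ?_
    · exact (Nat.coprime_two_right.2 hodd).pow_right 2
    · by_contra hc
      have : jacobiSym N n₀ = 0 := by
        rw [jacobiSym.eq_zero_iff]
        exact ⟨hodd.pos.ne', by rw [Nat.coprime_comm] at hc; simpa using hc⟩
      rw [this] at hn₀
      norm_num at hn₀
  have hval : oddJacobi N n₀ = -1 := by rw [oddJacobi, if_pos hodd, hn₀]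
  have h1 : ∑ n ∈ Finset.range (4 * N), oddJacobi N n = ∑ x : ZMod (4 * N), oddJacobi N x.val := by
    refine Finset.sum_bij' (fun n _ => (n : ZMod (4 * N))) (fun x _ => x.val) ?_ ?_ ?_ ?_ ?_
    · simp
    · intro x _; exact Finset.mem_range.2 (ZMod.val_lt x)
    · intro n hn; exact ZMod.val_cast_of_lt (Finset.mem_range.1 hn)
    · intro x _; simp
    · intro n hn; rw [ZMod.val_cast_of_lt (Finset.mem_range.1 hn)]
  have h2 : ∑ x : ZMod (4 * N), oddJacobi N x.val = ∑ x : ZMod (4 * N), - oddJacobi N x.val := by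
    rw [← Equiv.sum_comp (Units.mulLeft (ZMod.unitOfCoprime n₀ hcop))]
    refine Finset.sum_congr rfl fun x _ => ?_
    rw [Units.mulLeft_apply, ZMod.coe_unitOfCoprime, ZMod.val_mul, (oddJacobi_periodic N).map_mod_nat,
      oddJacobi_mul, ZMod.val_natCast, (oddJacobi_periodic N).map_mod_nat, hval]
    ring
  rw [h1]
  rw [Finset.sum_neg_distrib] at h2
  omega

theorem abs_sum_Ioc_oddJacobi_le {N : ℕ} (hN : ¬ IsSquare N) (a b : ℕ) :
    |∑ n ∈ Finset.Ioc a b, oddJacobi N n| ≤ 8 * N := by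
  have hN0 : N ≠ 0 := by rintro rfl; exact hN ⟨0, rfl⟩
  set F : ℕ → ℤ := fun n => ∑ i ∈ Finset.range n, oddJacobi N i with hF
  have hper : Function.Periodic F (4 * N) := by
    intro n
    simp only [hF]
    rw [add_comm, Finset.sum_range_add, sum_oddJacobi_period hN, zero_add]
    refine Finset.sum_congr rfl fun i _ => ?_
    rw [add_comm]
    exact oddJacobi_periodic N i
  have hbd : ∀ n, |F n| ≤ 4 * N := by
    intro n
    rw [← hper.map_mod_nat]
    refine (Finset.abs_sum_le_sum_abs _ _).trans ?_
    refine (Finset.sum_le_sum fun i _ => abs_oddJacobi_le_one N i).trans ?_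
    have := Nat.mod_lt n (show 4 * N > 0 by omega)
    simp only [Finset.sum_const, Finset.card_range, nsmul_eq_mul, mul_one]
    exact_mod_cast this.le
  rcases le_total a b with hab | hab
  · have h1 : ∑ n ∈ Finset.Ioc a b, oddJacobi N n = F (b + 1) - F (a + 1) := by
      rw [← Finset.sum_Ico_eq_sub _ (by omega)]
      refine Finset.sum_congr ?_ fun _ _ => rfl
      ext x; simp only [Finset.mem_Ioc, Finset.mem_Ico]; omega
    rw [h1]
    refine (abs_sub _ _).trans ?_
    linarith [hbd (b + 1), hbd (a + 1)]
  · rw [Finset.Ioc_eq_empty (by omega)]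
    simp

theorem sum_Ioc_filter_dvd {β : Type*} [AddCommMonoid β] (f : ℕ → β) {e : ℕ} (he : 0 < e) (a b : ℕ) :
    ∑ n ∈ (Finset.Ioc a b).filter (e ∣ ·), f n = ∑ k ∈ Finset.Ioc (a / e) (b / e), f (e * k) := by
  symm
  refine Finset.sum_bij (fun k _ => e * k) ?_ ?_ ?_ (fun _ _ => rfl)
  · intro k hk
    obtain ⟨h1, h2⟩ := Finset.mem_Ioc.1 hk
    rw [Nat.div_lt_iff_lt_mul he] at h1
    rw [Nat.le_div_iff_mul_le he] at h2
    simp only [Finset.mem_filter, Finset.mem_Ioc, dvd_mul_right, and_true]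
    constructor <;> linarith
  · intro k _ k' _ h
    exact Nat.eq_of_mul_eq_mul_left he h
  · intro n hn
    obtain ⟨h1, k, rfl⟩ := Finset.mem_filter.1 hn
    obtain ⟨h1, h2⟩ := Finset.mem_Ioc.1 h1
    refine ⟨k, Finset.mem_Ioc.2 ⟨?_, ?_⟩, rfl⟩
    · rw [Nat.div_lt_iff_lt_mul he]; linarith
    · rw [Nat.le_div_iff_mul_le he]; linarith

/-- The Selberg majorant `n ↦ (∑_{d ∣ n, d ≤ D} w d)²`. -/
def sieveWeight (D : ℕ) (w : ℕ → ℝ) (n : ℕ) : ℝ :=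
  (∑ d ∈ Finset.Icc 1 D, if d ∣ n then w d else 0) ^ 2

theorem sieveWeight_nonneg (D : ℕ) (w : ℕ → ℝ) (n : ℕ) : 0 ≤ sieveWeight D w n := sq_nonneg _

theorem sieveWeight_prime {D : ℕ} {w : ℕ → ℝ} (hD : 1 ≤ D) (hw : w 1 = 1) {p : ℕ} (hp : p.Prime)
    (hDp : D < p) : sieveWeight D w p = 1 := by
  rw [sieveWeight, Finset.sum_eq_single 1, if_pos (one_dvd _), hw, one_pow]
  · intro d hd hd1
    rw [if_neg]
    intro hdvd
    rcases (Nat.dvd_prime hp).1 hdvd with h | h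
    · exact hd1 h
    · have := (Finset.mem_Icc.1 hd).2; omega
  · intro h
    exact absurd (Finset.mem_Icc.2 ⟨le_rfl, hD⟩) h

theorem sum_sieveWeight_mul (D : ℕ) (w f : ℕ → ℝ) (A B : ℕ) :
    ∑ n ∈ Finset.Ioc A B, sieveWeight D w n * f n = ∑ a ∈ Finset.Icc 1 D, ∑ b ∈ Finset.Icc 1 D,
      w a * w b * ∑ n ∈ (Finset.Ioc A B).filter (Nat.lcm a b ∣ ·), f n := by
  have h1 : ∀ n ∈ Finset.Ioc A B, sieveWeight D w n * f n = ∑ a ∈ Finset.Icc 1 D, ∑ b ∈ Finset.Icc 1 D,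
      w a * w b * (if Nat.lcm a b ∣ n then f n else 0) := by
    intro n _
    rw [sieveWeight, sq, Finset.sum_mul_sum, Finset.sum_mul]
    refine Finset.sum_congr rfl fun a _ => ?_
    rw [Finset.sum_mul]
    refine Finset.sum_congr rfl fun b _ => ?_
    by_cases ha : a ∣ n <;> by_cases hb : b ∣ n <;> simp [ha, hb, Nat.lcm_dvd_iff]
  rw [Finset.sum_congr rfl h1, Finset.sum_comm]
  refine Finset.sum_congr rfl fun a _ => ?_
  rw [Finset.sum_comm]
  refine Finset.sum_congr rfl fun b _ => ?_
  rw [← Finset.mul_sum, Finset.sum_filter]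

theorem abs_sum_weights_mul_le {D : ℕ} {w : ℕ → ℝ} (hwD : ∀ d ∈ Finset.Icc 1 D, |w d| ≤ (D : ℝ) ^ 2)
    {E : ℕ → ℕ → ℝ} {K : ℝ} (hE : ∀ a ∈ Finset.Icc 1 D, ∀ b ∈ Finset.Icc 1 D, |E a b| ≤ K) :
    |∑ a ∈ Finset.Icc 1 D, ∑ b ∈ Finset.Icc 1 D, w a * w b * E a b| ≤ (D : ℝ) ^ 6 * K := by
  have h1 : ∀ a ∈ Finset.Icc 1 D, ∀ b ∈ Finset.Icc 1 D, |w a * w b * E a b| ≤ (D : ℝ) ^ 4 * K := by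
    intro a ha b hb
    rw [abs_mul, abs_mul]
    have := mul_le_mul (hwD a ha) (hwD b hb) (abs_nonneg _) (by positivity)
    refine mul_le_mul (this.trans_eq (by ring)) (hE a ha b hb) (abs_nonneg _) (by positivity)
  refine (Finset.abs_sum_le_sum_abs _ _).trans ?_
  refine (Finset.sum_le_sum fun a ha => (Finset.abs_sum_le_sum_abs _ _).trans
    (Finset.sum_le_sum fun b hb => h1 a ha b hb)).trans ?_
  simp only [Finset.sum_const, Nat.card_Icc, add_tsub_cancel_right, nsmul_eq_mul]
  exact le_of_eq (by ring)

theorem sum_sieveWeight_le {D : ℕ} {w : ℕ → ℝ} (hwD : ∀ d ∈ Finset.Icc 1 D, |w d| ≤ (D : ℝ) ^ 2)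
    (hQ : ∑ a ∈ Finset.Icc 1 D, ∑ b ∈ Finset.Icc 1 D, w a * w b / (Nat.lcm a b : ℝ) ≤ 2 / Real.log D)
    {A B : ℕ} (hAB : A ≤ B) :
    ∑ n ∈ Finset.Ioc A B, sieveWeight D w n ≤ ((B : ℝ) - A) * (2 / Real.log D) + (D : ℝ) ^ 6 := by
  have h1 := sum_sieveWeight_mul D w (fun _ => 1) A B
  simp only [mul_one] at h1
  set E : ℕ → ℕ → ℝ := fun a b => (∑ n ∈ (Finset.Ioc A B).filter (Nat.lcm a b ∣ ·), (1 : ℝ))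
    - ((B : ℝ) - A) / (Nat.lcm a b : ℝ) with hE
  have hEb : ∀ a ∈ Finset.Icc 1 D, ∀ b ∈ Finset.Icc 1 D, |E a b| ≤ 1 := by
    intro a ha b hb
    have he : 0 < Nat.lcm a b := Nat.lcm_pos (Finset.mem_Icc.1 ha).1 (Finset.mem_Icc.1 hb).1
    simp only [hE]
    rw [sum_Ioc_filter_dvd _ he]
    set e := Nat.lcm a b
    have hdiv : A / e ≤ B / e := Nat.div_le_div_right hAB
    simp only [Finset.sum_const, Nat.card_Ioc, nsmul_eq_mul, mul_one]
    rw [Nat.cast_sub hdiv]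
    have e0 : (0 : ℝ) < e := by exact_mod_cast he
    have fA1 : ((A / e : ℕ) : ℝ) ≤ A / e := Nat.cast_div_le
    have fB1 : ((B / e : ℕ) : ℝ) ≤ B / e := Nat.cast_div_le
    have fl : ∀ n : ℕ, (n : ℝ) / e < ((n / e : ℕ) : ℝ) + 1 := by
      intro n
      rw [div_lt_iff₀ e0]
      exact_mod_cast Nat.lt_mul_of_div_lt (Nat.lt_succ_self _) he
    have fA2 := fl A
    have fB2 := fl B
    rw [abs_le, sub_div]
    constructor <;> linarith
  have h2 : ∑ n ∈ Finset.Ioc A B, sieveWeight D w n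
      = ((B : ℝ) - A) * (∑ a ∈ Finset.Icc 1 D, ∑ b ∈ Finset.Icc 1 D, w a * w b / (Nat.lcm a b : ℝ))
        + ∑ a ∈ Finset.Icc 1 D, ∑ b ∈ Finset.Icc 1 D, w a * w b * E a b := by
    rw [h1, Finset.mul_sum, ← Finset.sum_add_distrib]
    refine Finset.sum_congr rfl fun a _ => ?_
    rw [Finset.mul_sum, ← Finset.sum_add_distrib]
    refine Finset.sum_congr rfl fun b _ => ?_
    simp only [hE]
    ring
  rw [h2]
  have h3 := (le_abs_self _).trans (abs_sum_weights_mul_le hwD hEb)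
  have h4 : (0 : ℝ) ≤ (B : ℝ) - A := by
    have : (A : ℝ) ≤ B := by exact_mod_cast hAB
    linarith
  have h5 := mul_le_mul_of_nonneg_left hQ h4
  linarith

theorem abs_sum_sieveWeight_mul_oddJacobi_le {D : ℕ} {w : ℕ → ℝ}
    (hwD : ∀ d ∈ Finset.Icc 1 D, |w d| ≤ (D : ℝ) ^ 2) {N : ℕ} (hN : ¬ IsSquare N) (A B : ℕ) :
    |∑ n ∈ Finset.Ioc A B, sieveWeight D w n * (oddJacobi N n : ℝ)| ≤ (D : ℝ) ^ 6 * (8 * N) := by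
  rw [sum_sieveWeight_mul]
  refine abs_sum_weights_mul_le hwD fun a ha b hb => ?_
  have he : 0 < Nat.lcm a b := Nat.lcm_pos (Finset.mem_Icc.1 ha).1 (Finset.mem_Icc.1 hb).1
  rw [sum_Ioc_filter_dvd _ he]
  simp only [oddJacobi_mul]
  push_cast
  rw [← Finset.mul_sum, abs_mul]
  have h1 : |(oddJacobi N (Nat.lcm a b) : ℝ)| ≤ 1 := by exact_mod_cast abs_oddJacobi_le_one N _
  have h2 : |∑ k ∈ Finset.Ioc (A / Nat.lcm a b) (B / Nat.lcm a b), (oddJacobi N k : ℝ)| ≤ 8 * N := by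
    exact_mod_cast abs_sum_Ioc_oddJacobi_le hN _ _
  calc _ ≤ 1 * (8 * (N : ℝ)) := mul_le_mul h1 h2 (abs_nonneg _) (by norm_num)
    _ = _ := one_mul _
theorem card_divisors_le_rpow {ε : ℝ} (hε : 0 < ε) :
    ∃ C : ℝ, 0 < C ∧ ∀ n : ℕ, n ≠ 0 → (n.divisors.card : ℝ) ≤ C * (n : ℝ) ^ ε := by
  have hlog2 : 0 < Real.log 2 := Real.log_pos (by norm_num)
  set K : ℝ := max 1 (1 / (ε * Real.log 2)) with hK
  have hK1 : 1 ≤ K := le_max_left _ _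
  set P : ℕ := ⌈(2 : ℝ) ^ (1 / ε)⌉₊ with hP
  refine ⟨K ^ P, by positivity, fun n hn => ?_⟩
  have hlocal : ∀ p : ℕ, p.Prime → ∀ a : ℕ,
      ((a + 1 : ℕ) : ℝ) ≤ (if p < P then K else 1) * ((p : ℝ) ^ a) ^ ε := by
    intro p hp a
    have hp2 : (2 : ℝ) ≤ p := by exact_mod_cast hp.two_le
    split_ifs with h
    · have h1 : 1 + a * (ε * Real.log 2) ≤ ((p : ℝ) ^ a) ^ ε := by
        calc 1 + a * (ε * Real.log 2) ≤ Real.exp (a * (ε * Real.log 2)) := by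
              rw [add_comm]; exact Real.add_one_le_exp _
          _ = ((2 : ℝ) ^ a) ^ ε := by
              rw [← Real.rpow_natCast, ← Real.rpow_mul (by norm_num), Real.rpow_def_of_pos (by norm_num)]
              congr 1; ring
          _ ≤ _ := by gcongr
      have h2 : 1 ≤ K * (ε * Real.log 2) := by
        have := le_max_right 1 (1 / (ε * Real.log 2))
        rw [← hK, div_le_iff₀ (by positivity)] at this
        exact this
      have h3 : (0 : ℝ) ≤ a := a.cast_nonneg
      push_cast
      nlinarith [mul_le_mul_of_nonneg_left h1 (show (0 : ℝ) ≤ K by linarith), mul_le_mul_of_nonneg_left h2 h3]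
    · have h1 : (2 : ℝ) ≤ (p : ℝ) ^ ε := by
        have h2 : (2 : ℝ) ^ (1 / ε) ≤ p := (Nat.le_ceil _).trans (by exact_mod_cast not_lt.1 h)
        calc (2 : ℝ) = ((2 : ℝ) ^ (1 / ε)) ^ ε := by
              rw [← Real.rpow_mul (by norm_num), one_div_mul_cancel hε.ne', Real.rpow_one]
          _ ≤ _ := by gcongr
      rw [one_mul, ← Real.rpow_pow_comm (by positivity)]
      calc ((a + 1 : ℕ) : ℝ) ≤ (2 : ℝ) ^ a := by exact_mod_cast Nat.lt_two_pow_self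
        _ ≤ _ := by gcongr
  have h1 : (n : ℝ) ^ ε = ∏ p ∈ n.primeFactors, ((p : ℝ) ^ n.factorization p) ^ ε := by
    rw [Real.finsetProd_rpow _ _ (fun _ _ => by positivity)]
    congr 1
    have := Nat.prod_factorization_pow_eq_self hn
    rw [Finsupp.prod, Nat.support_factorization] at this
    exact_mod_cast this.symm
  rw [Nat.card_divisors hn, h1]
  push_cast
  refine (Finset.prod_le_prod (fun _ _ => by positivity) fun p hp => by
    have := hlocal p (Nat.prime_of_mem_primeFactors hp) (n.factorization p)
    push_cast at this
    exact this).trans ?_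
  rw [Finset.prod_mul_distrib]
  refine mul_le_mul_of_nonneg_right ?_ (Finset.prod_nonneg fun _ _ => by positivity)
  rw [← Finset.prod_filter, Finset.prod_const]
  refine pow_le_pow_right₀ hK1 ?_
  calc _ ≤ (Finset.range P).card := Finset.card_le_card fun p hp => by
        simpa using (Finset.mem_filter.1 hp).2
    _ = P := Finset.card_range _

/-- The shifted product `∏_{j ∈ J} (m + j)`. -/
def shiftProd (J : Finset ℕ) (m : ℕ) : ℕ := ∏ j ∈ J, (m + j)

theorem shiftProd_pos {J : Finset ℕ} {m : ℕ} (hm : 1 ≤ m) : 0 < shiftProd J m :=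
  Finset.prod_pos fun _ _ => by omega

theorem shiftProd_le {J : Finset ℕ} {m G : ℕ} (hm : m ≤ G) (hJ : ∀ j ∈ J, j ≤ G) :
    shiftProd J m ≤ (2 * G) ^ J.card :=
  Finset.prod_le_pow_card _ _ _ fun j hj => by have := hJ j hj; omega

theorem squarefree_part_dvd {J : Finset ℕ} {i m m' a b : ℕ} (hi : i ∈ J) (hm : 1 ≤ m) (hm' : 1 ≤ m')
    (hab : a ^ 2 * b = m + i) (hb : Squarefree b) (hsq : IsSquare (shiftProd J m * shiftProd J m')) :
    b ∣ (∏ j ∈ J.erase i, Nat.dist j i) * shiftProd J m' := by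
  rw [← Nat.prod_primeFactors_of_squarefree hb]
  refine Finset.prod_primes_dvd _ (fun p hp => (Nat.prime_of_mem_primeFactors hp).prime) fun p hp => ?_
  have hpp := Nat.prime_of_mem_primeFactors hp
  have hpb := Nat.dvd_of_mem_primeFactors hp
  by_contra hcon
  have hΔ : ¬ p ∣ ∏ j ∈ J.erase i, Nat.dist j i := fun h => hcon (h.mul_right _)
  have hP' : ¬ p ∣ shiftProd J m' := fun h => hcon (h.mul_left _)
  have hR : ¬ p ∣ ∏ j ∈ J.erase i, (m + j) := by
    intro h
    obtain ⟨j, hj, hpj⟩ := (hpp.prime.dvd_finsetProd_iff _).1 h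
    refine hΔ (dvd_trans ?_ (Finset.dvd_prod_of_mem _ hj))
    have hpi : p ∣ m + i := hab ▸ hpb.mul_left _
    have h1 : Nat.dist j i = Nat.dist (m + j) (m + i) := by
      rw [Nat.dist_add_add_left]
    rw [h1, Nat.dist]
    exact dvd_add (Nat.dvd_sub hpj hpi) (Nat.dvd_sub hpi hpj)
  have hprod : shiftProd J m = a ^ 2 * b * ∏ j ∈ J.erase i, (m + j) := by
    rw [hab, shiftProd, Finset.mul_prod_erase _ _ hi]
  obtain ⟨z, hz⟩ := hsq
  have hb0 : b ≠ 0 := hb.ne_zero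
  have ha0 : a ≠ 0 := by rintro rfl; simp at hab; omega
  have hR0 : ∏ j ∈ J.erase i, (m + j) ≠ 0 := Finset.prod_ne_zero_iff.2 fun _ _ => by omega
  have hP0 : shiftProd J m' ≠ 0 := (shiftProd_pos hm').ne'
  have hz0 : z ≠ 0 := by
    rintro rfl
    have := (shiftProd_pos (J := J) hm).ne'
    simp [this, hP0] at hz
  have hv := congrArg (fun x => x.factorization p) hz
  rw [hprod] at hv
  have hvb : b.factorization p = 1 := by
    have h1 := (Nat.squarefree_iff_factorization_le_one hb0).1 hb p
    have h2 := (hpp.dvd_iff_one_le_factorization hb0).1 hpb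
    omega
  simp only [Nat.factorization_mul (mul_ne_zero (mul_ne_zero (pow_ne_zero 2 ha0) hb0) hR0) hP0,
    Nat.factorization_mul (mul_ne_zero (pow_ne_zero 2 ha0) hb0) hR0,
    Nat.factorization_mul (pow_ne_zero 2 ha0) hb0, Nat.factorization_mul hz0 hz0,
    Nat.factorization_pow, Finsupp.add_apply, Finsupp.smul_apply, smul_eq_mul, hvb,
    Nat.factorization_eq_zero_of_not_dvd hR, Nat.factorization_eq_zero_of_not_dvd hP'] at hv
  omega

theorem card_square_pairs_le {k : ℕ} (hk : 1 ≤ k) : ∃ C : ℝ, 0 < C ∧ ∀ J : Finset ℕ, J.card = k →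
    ∀ G : ℕ, 1 ≤ G → (∀ j ∈ J, j ≤ G) → ∀ m' ∈ Finset.Icc 1 G,
      (((Finset.Icc 1 G).filter fun m => IsSquare (shiftProd J m * shiftProd J m')).card : ℝ)
        ≤ C * (G : ℝ) ^ (0.6 : ℝ) := by
  have hk0 : (0 : ℝ) < k := by exact_mod_cast hk
  obtain ⟨C, hC, hdiv⟩ := card_divisors_le_rpow (ε := 0.1 / (2 * k)) (by positivity)
  refine ⟨C * 2 ^ (0.6 : ℝ), by positivity, fun J hJ G hG hJG m' hm' => ?_⟩
  obtain ⟨i, hi⟩ : J.Nonempty := Finset.card_pos.1 (by omega)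
  obtain ⟨hm'1, hm'2⟩ := Finset.mem_Icc.1 hm'
  set M0 := (∏ j ∈ J.erase i, Nat.dist j i) * shiftProd J m' with hM0
  have hM0' : M0 ≠ 0 := by
    refine mul_ne_zero (Finset.prod_ne_zero_iff.2 fun j hj => ?_) (shiftProd_pos hm'1).ne'
    intro h
    exact (Finset.mem_erase.1 hj).1 (Nat.eq_of_dist_eq_zero h)
  have hM0le : M0 ≤ (2 * G) ^ (2 * k) := by
    have h1 : ∏ j ∈ J.erase i, Nat.dist j i ≤ (2 * G) ^ (J.erase i).card := by
      refine Finset.prod_le_pow_card _ _ _ fun j hj => ?_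
      have := hJG j (Finset.mem_of_mem_erase hj)
      have := hJG i hi
      simp only [Nat.dist]; omega
    have h2 : (2 * G) ^ (J.erase i).card ≤ (2 * G) ^ k :=
      Nat.pow_le_pow_right (by omega) (by rw [← hJ]; exact Finset.card_le_card (Finset.erase_subset _ _))
    have h3 := shiftProd_le (J := J) hm'2 hJG
    rw [hJ] at h3
    calc M0 ≤ (2 * G) ^ k * (2 * G) ^ k := Nat.mul_le_mul (h1.trans h2) h3
      _ = _ := by ring
  have hcard : ((Finset.Icc 1 G).filter fun m => IsSquare (shiftProd J m * shiftProd J m')).card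
      ≤ (M0.divisors ×ˢ Finset.Icc 1 (Nat.sqrt (2 * G))).card := by
    have hex : ∀ n : ℕ, ∃ x : ℕ × ℕ, x.2 ^ 2 * x.1 = n ∧ Squarefree x.1 := by
      intro n
      obtain ⟨a, b, hab, hsq⟩ := Nat.sq_mul_squarefree n
      exact ⟨(a, b), hab, hsq⟩
    choose f hf using hex
    refine Finset.card_le_card_of_injOn (fun m => f (m + i)) ?_ ?_
    · intro m hm
      obtain ⟨hm1, hsq⟩ := Finset.mem_filter.1 hm
      obtain ⟨hm1, hm2⟩ := Finset.mem_Icc.1 hm1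
      obtain ⟨he, hs⟩ := hf (m + i)
      have hb0 : 0 < (f (m + i)).1 := Nat.pos_of_ne_zero hs.ne_zero
      have ha0 : 0 < (f (m + i)).2 := by
        rcases Nat.eq_zero_or_pos (f (m + i)).2 with h | h
        · rw [h] at he; simp at he; omega
        · exact h
      have := hJG i hi
      simp only [Finset.coe_product, Set.mem_prod, Finset.mem_coe, Nat.mem_divisors, Finset.mem_Icc]
      refine ⟨⟨squarefree_part_dvd hi hm1 hm'1 he hs hsq, hM0'⟩, ha0, ?_⟩
      rw [Nat.le_sqrt']
      nlinarith [Nat.pow_pos ha0 (n := 2)]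
    · intro m _ m₂ _ h
      have h1 := (hf (m + i)).1
      have h2 := (hf (m₂ + i)).1
      simp only at h
      rw [h, h2] at h1
      omega
  rw [Finset.card_product, Nat.card_Icc, Nat.add_sub_cancel] at hcard
  have hG0 : (0 : ℝ) < G := by exact_mod_cast hG
  have h1 : (M0.divisors.card : ℝ) ≤ C * ((2 * G : ℝ) ^ (0.1 : ℝ)) := by
    refine (hdiv M0 hM0').trans (mul_le_mul_of_nonneg_left ?_ hC.le)
    calc (M0 : ℝ) ^ (0.1 / (2 * k) : ℝ) ≤ ((2 * G : ℝ) ^ (2 * k : ℕ)) ^ (0.1 / (2 * k) : ℝ) := by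
          gcongr
          exact_mod_cast hM0le
      _ = _ := by
          rw [← Real.rpow_natCast, ← Real.rpow_mul (by positivity)]
          congr 1
          push_cast
          field_simp
  have h2 : (Nat.sqrt (2 * G) : ℝ) ≤ (2 * G : ℝ) ^ (0.5 : ℝ) := by
    have := Real.nat_sqrt_le_real_sqrt (a := 2 * G)
    rw [Real.sqrt_eq_rpow] at this
    norm_num at this ⊢
    exact this
  calc _ ≤ ((M0.divisors.card * Nat.sqrt (2 * G) : ℕ) : ℝ) := by exact_mod_cast hcard
    _ ≤ (C * ((2 * G : ℝ) ^ (0.1 : ℝ))) * (2 * G : ℝ) ^ (0.5 : ℝ) := by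
        push_cast
        exact mul_le_mul h1 h2 (by positivity) (by positivity)
    _ = _ := by
        rw [mul_assoc, ← Real.rpow_add (by positivity), mul_assoc, ← Real.mul_rpow (by norm_num) (by positivity)]
        norm_num
theorem oddJacobi_mul_left (a b n : ℕ) : oddJacobi (a * b) n = oddJacobi a n * oddJacobi b n := by
  unfold oddJacobi
  split_ifs
  · push_cast
    rw [jacobiSym.mul_left]
  · simp

theorem sum_sieveWeight_mul_sq_le {D : ℕ} {w : ℕ → ℝ}
    (hwD : ∀ d ∈ Finset.Icc 1 D, |w d| ≤ (D : ℝ) ^ 2) {J : Finset ℕ} {G : ℕ} {c L : ℝ}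
    (hpairs : ∀ m' ∈ Finset.Icc 1 G,
      (((Finset.Icc 1 G).filter fun m => IsSquare (shiftProd J m * shiftProd J m')).card : ℝ) ≤ c)
    (hL : ∀ m ∈ Finset.Icc 1 G, (shiftProd J m : ℝ) ≤ L) (A B : ℕ) :
    ∑ n ∈ Finset.Ioc A B, sieveWeight D w n *
        (∑ m ∈ Finset.Icc 1 G, (oddJacobi (shiftProd J m) n : ℝ)) ^ 2
      ≤ G * c * (∑ n ∈ Finset.Ioc A B, sieveWeight D w n) + (G : ℝ) ^ 2 * ((D : ℝ) ^ 6 * (8 * L ^ 2)) := by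
  set W := ∑ n ∈ Finset.Ioc A B, sieveWeight D w n with hW
  have hW0 : 0 ≤ W := Finset.sum_nonneg fun _ _ => sieveWeight_nonneg _ _ _
  have h1 : ∑ n ∈ Finset.Ioc A B, sieveWeight D w n *
        (∑ m ∈ Finset.Icc 1 G, (oddJacobi (shiftProd J m) n : ℝ)) ^ 2
      = ∑ m' ∈ Finset.Icc 1 G, ∑ m ∈ Finset.Icc 1 G, ∑ n ∈ Finset.Ioc A B,
        sieveWeight D w n * (oddJacobi (shiftProd J m * shiftProd J m') n : ℝ) := by
    have : ∀ n ∈ Finset.Ioc A B, sieveWeight D w n *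
        (∑ m ∈ Finset.Icc 1 G, (oddJacobi (shiftProd J m) n : ℝ)) ^ 2
        = ∑ m' ∈ Finset.Icc 1 G, ∑ m ∈ Finset.Icc 1 G,
        sieveWeight D w n * (oddJacobi (shiftProd J m * shiftProd J m') n : ℝ) := by
      intro n _
      rw [sq, Finset.sum_mul_sum, Finset.sum_comm, Finset.mul_sum]
      refine Finset.sum_congr rfl fun m' _ => ?_
      rw [Finset.mul_sum]
      refine Finset.sum_congr rfl fun m _ => ?_
      rw [oddJacobi_mul_left]
      push_cast
      rfl
    rw [Finset.sum_congr rfl this, Finset.sum_comm]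
    refine Finset.sum_congr rfl fun m' _ => ?_
    rw [Finset.sum_comm]
  rw [h1]
  have h2 : ∀ m' ∈ Finset.Icc 1 G, ∑ m ∈ Finset.Icc 1 G, ∑ n ∈ Finset.Ioc A B,
        sieveWeight D w n * (oddJacobi (shiftProd J m * shiftProd J m') n : ℝ)
      ≤ c * W + G * ((D : ℝ) ^ 6 * (8 * L ^ 2)) := by
    intro m' hm'
    have h3 : ∀ m ∈ Finset.Icc 1 G, ∑ n ∈ Finset.Ioc A B,
        sieveWeight D w n * (oddJacobi (shiftProd J m * shiftProd J m') n : ℝ)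
        ≤ (if IsSquare (shiftProd J m * shiftProd J m') then W else 0) + (D : ℝ) ^ 6 * (8 * L ^ 2) := by
      intro m hm
      split_ifs with hs
      · have : ∑ n ∈ Finset.Ioc A B,
            sieveWeight D w n * (oddJacobi (shiftProd J m * shiftProd J m') n : ℝ) ≤ W := by
          refine Finset.sum_le_sum fun n _ => ?_
          have h4 : (oddJacobi (shiftProd J m * shiftProd J m') n : ℝ) ≤ 1 := by
            exact_mod_cast (abs_le.1 (abs_oddJacobi_le_one (shiftProd J m * shiftProd J m') n)).2
          exact mul_le_of_le_one_right (sieveWeight_nonneg _ _ _) h4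
        have : 0 ≤ (D : ℝ) ^ 6 * (8 * L ^ 2) := by positivity
        linarith
      · rw [zero_add]
        refine (le_abs_self _).trans ((abs_sum_sieveWeight_mul_oddJacobi_le hwD hs A B).trans ?_)
        have h5 : (0 : ℝ) ≤ shiftProd J m := Nat.cast_nonneg _
        have h6 : (0 : ℝ) ≤ shiftProd J m' := Nat.cast_nonneg _
        push_cast
        have := mul_le_mul (hL m hm) (hL m' hm') h6 (h5.trans (hL m hm))
        gcongr
        linarith
    refine (Finset.sum_le_sum h3).trans ?_
    rw [Finset.sum_add_distrib, ← Finset.sum_filter, Finset.sum_const, Finset.sum_const, Nat.card_Icc,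
      Nat.add_sub_cancel, nsmul_eq_mul, nsmul_eq_mul]
    have := mul_le_mul_of_nonneg_right (hpairs m' hm') hW0
    linarith
  refine (Finset.sum_le_sum h2).trans ?_
  rw [Finset.sum_const, Nat.card_Icc, Nat.add_sub_cancel, nsmul_eq_mul]
  exact le_of_eq (by ring)

theorem card_large_sums_le {D : ℕ} (hD : 2 ≤ D) {𝒥 : Finset (Finset ℕ)} {G A B : ℕ} (hAB : A ≤ B)
    {c L T : ℝ} (hT : 0 ≤ T) (hc : 0 ≤ c)
    (hpairs : ∀ J ∈ 𝒥, ∀ m' ∈ Finset.Icc 1 G,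
      (((Finset.Icc 1 G).filter fun m => IsSquare (shiftProd J m * shiftProd J m')).card : ℝ) ≤ c)
    (hL : ∀ J ∈ 𝒥, ∀ m ∈ Finset.Icc 1 G, (shiftProd J m : ℝ) ≤ L)
    {E : Finset ℕ} (hE : E ⊆ Finset.Ioc A B) (hprime : ∀ p ∈ E, p.Prime ∧ D < p)
    (hlarge : ∀ p ∈ E, ∃ J ∈ 𝒥, T ≤ |∑ m ∈ Finset.Icc 1 G, (jacobiSym (shiftProd J m) p : ℝ)|) :
    (E.card : ℝ) * T ^ 2 ≤ 𝒥.card * (G * c * (((B : ℝ) - A) * (2 / Real.log D) + (D : ℝ) ^ 6)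
      + (G : ℝ) ^ 2 * ((D : ℝ) ^ 6 * (8 * L ^ 2))) := by
  obtain ⟨w, hw1, hwD, hQ⟩ := exists_selberg_weights hD
  have hW := sum_sieveWeight_le hwD hQ hAB
  have h1 : ∀ p ∈ E, T ^ 2 ≤ ∑ J ∈ 𝒥, sieveWeight D w p *
      (∑ m ∈ Finset.Icc 1 G, (oddJacobi (shiftProd J m) p : ℝ)) ^ 2 := by
    intro p hp
    obtain ⟨hpp, hDp⟩ := hprime p hp
    obtain ⟨J, hJ, hTJ⟩ := hlarge p hp
    have hodd : Odd p := hpp.odd_of_ne_two (by omega)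
    refine le_trans ?_ (Finset.single_le_sum (f := fun J => sieveWeight D w p *
      (∑ m ∈ Finset.Icc 1 G, (oddJacobi (shiftProd J m) p : ℝ)) ^ 2)
      (fun _ _ => mul_nonneg (sieveWeight_nonneg _ _ _) (sq_nonneg _)) hJ)
    simp only [sieveWeight_prime (by omega) hw1 hpp hDp, one_mul, oddJacobi, if_pos hodd]
    rw [← sq_abs (∑ m ∈ Finset.Icc 1 G, (jacobiSym (shiftProd J m) p : ℝ))]
    exact pow_le_pow_left₀ hT hTJ 2
  calc (E.card : ℝ) * T ^ 2 = ∑ p ∈ E, T ^ 2 := by rw [Finset.sum_const, nsmul_eq_mul]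
    _ ≤ ∑ p ∈ E, ∑ J ∈ 𝒥, sieveWeight D w p *
      (∑ m ∈ Finset.Icc 1 G, (oddJacobi (shiftProd J m) p : ℝ)) ^ 2 := Finset.sum_le_sum h1
    _ ≤ ∑ p ∈ Finset.Ioc A B, ∑ J ∈ 𝒥, sieveWeight D w p *
      (∑ m ∈ Finset.Icc 1 G, (oddJacobi (shiftProd J m) p : ℝ)) ^ 2 :=
        Finset.sum_le_sum_of_subset_of_nonneg hE fun _ _ _ =>
          Finset.sum_nonneg fun _ _ => mul_nonneg (sieveWeight_nonneg _ _ _) (sq_nonneg _)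
    _ = ∑ J ∈ 𝒥, ∑ p ∈ Finset.Ioc A B, sieveWeight D w p *
      (∑ m ∈ Finset.Icc 1 G, (oddJacobi (shiftProd J m) p : ℝ)) ^ 2 := Finset.sum_comm
    _ ≤ ∑ J ∈ 𝒥, (G * c * (((B : ℝ) - A) * (2 / Real.log D) + (D : ℝ) ^ 6)
      + (G : ℝ) ^ 2 * ((D : ℝ) ^ 6 * (8 * L ^ 2))) := by
        refine Finset.sum_le_sum fun J hJ =>
          (sum_sieveWeight_mul_sq_le hwD (hpairs J hJ) (hL J hJ) A B).trans ?_
        gcongr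
    _ = _ := by rw [Finset.sum_const, nsmul_eq_mul]

/-- Primes `q` with a long correlation sum over `k` shifts that is unusually large. -/
def correlatedPrimes (g : ℝ → ℝ) (k : ℕ) : Set ℕ :=
  {q | q.Prime ∧ ∃ J : Finset ℕ, J.card = k ∧ (∀ j ∈ J, (j : ℝ) ^ (100 * k) ≤ g q) ∧
    g q ^ (0.995 : ℝ) < |∑ m ∈ Finset.Icc 1 ⌊g q⌋₊, (jacobiSym (shiftProd J m) q : ℝ)|}

/-- The part of a set of naturals lying in `[X, X + X ^ η]`. -/
def shortWindow (E : Set ℕ) (η X : ℝ) : Set ℕ := {p | p ∈ E ∧ X ≤ p ∧ (p : ℝ) ≤ X + X ^ η}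

theorem shortWindow_finite (E : Set ℕ) (η X : ℝ) : (shortWindow E η X).Finite :=
  (Set.finite_Iic ⌊X + X ^ η⌋₊).subset fun _ hp => Nat.le_floor hp.2.2

set_option maxHeartbeats 2000000 in
theorem ncard_window_correlatedPrimes_le {k : ℕ} (hk : 1 ≤ k) {Cs : ℝ} (hCs : 0 < Cs)
    (hsq : ∀ J : Finset ℕ, J.card = k →
      ∀ G : ℕ, 1 ≤ G → (∀ j ∈ J, j ≤ G) → ∀ m' ∈ Finset.Icc 1 G,
      (((Finset.Icc 1 G).filter fun m => IsSquare (shiftProd J m * shiftProd J m')).card : ℝ)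
        ≤ Cs * (G : ℝ) ^ (0.6 : ℝ))
    {g : ℝ → ℝ} {X C : ℝ} (hmono : StrictMono g) (hdiff : Differentiable ℝ g)
    (hder : ∀ c ∈ Set.Icc X (X + X ^ (0.01 : ℝ)), |deriv g c| ≤ C * g X ^ (0.99 : ℝ) * X ^ (-0.01 : ℝ))
    (hg2 : 2 ≤ g X) (hCg : C * g X ^ (0.99 : ℝ) + 1 ≤ g X ^ (0.995 : ℝ) / 2)
    (hCg' : C * g X ^ (0.99 : ℝ) ≤ g X) (hgX : (2 * g X) ^ (2 * k) ≤ X ^ (0.001 : ℝ))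
    (hX1 : 1 < X) (hXD : 2 ≤ X ^ (0.0001 : ℝ)) (hXlog : Real.log 2 ≤ 0.00005 * Real.log X)
    (hX6 : X ^ (0.0006 : ℝ) ≤ X ^ (0.01 : ℝ) / Real.log X) :
    ((shortWindow (correlatedPrimes g k) 0.01 X).ncard : ℝ) ≤
      2 ^ k * 8 * (80001 * Cs * g X ^ (-0.38 : ℝ) * (X ^ (0.01 : ℝ) / Real.log X) + 8 * X ^ (0.0026 : ℝ)) := by
  set γ := g X with hγ
  set F := X ^ (0.01 : ℝ) / Real.log X with hF
  have hX0 : 0 < X := by linarith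
  have hγ0 : 0 < γ := by linarith
  have hlogX : 0 < Real.log X := Real.log_pos hX1
  have hY1 : 1 ≤ X ^ (0.01 : ℝ) := Real.one_le_rpow hX1.le (by norm_num)
  set G := ⌊γ⌋₊ with hG
  have hG1 : 1 ≤ G := Nat.le_floor (by push_cast; linarith)
  have hGγ : (G : ℝ) ≤ γ := Nat.floor_le hγ0.le
  set D := ⌊X ^ (0.0001 : ℝ)⌋₊ with hD
  have hD2 : 2 ≤ D := Nat.le_floor (by exact_mod_cast hXD)
  have hDX : (D : ℝ) ≤ X ^ (0.0001 : ℝ) := Nat.floor_le (by positivity)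
  have hlogD : 0.00005 * Real.log X ≤ Real.log D := by
    have h1 : X ^ (0.0001 : ℝ) / 2 ≤ D := by
      have := Nat.lt_floor_add_one (X ^ (0.0001 : ℝ))
      rw [← hD] at this
      have h2 : (2 : ℝ) ≤ D := by exact_mod_cast hD2
      linarith
    have h2 := Real.log_le_log (by positivity) h1
    rw [Real.log_div (by positivity) (by norm_num), Real.log_rpow hX0] at h2
    linarith
  set A := ⌈X⌉₊ - 1 with hA
  set B := ⌊X + X ^ (0.01 : ℝ)⌋₊ with hB
  have hceil : 1 ≤ ⌈X⌉₊ := Nat.one_le_ceil_iff.2 hX0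
  have hAX : X - 1 ≤ (A : ℝ) := by
    have := Nat.le_ceil X
    rw [hA, Nat.cast_sub hceil]
    push_cast; linarith
  have hAX' : (A : ℝ) < X := by
    have := Nat.ceil_lt_add_one hX0.le
    rw [hA, Nat.cast_sub hceil]
    push_cast; linarith
  have hBX : (B : ℝ) ≤ X + X ^ (0.01 : ℝ) := Nat.floor_le (by positivity)
  have hAB : A ≤ B := Nat.le_floor (by linarith)
  set ν : ℝ := (2 * γ) ^ ((100 * k : ℕ) : ℝ)⁻¹ with hν
  have h100k : 100 * k ≠ 0 := by omega
  have hν1 : 1 ≤ ν := Real.one_le_rpow (by linarith) (by positivity)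
  set H := ⌊ν⌋₊ with hH
  have hHG : H ≤ G := by
    refine Nat.floor_le_floor ?_
    calc ν ≤ (2 * γ) ^ (1 / 2 : ℝ) := by
          refine Real.rpow_le_rpow_of_exponent_le (by linarith) ?_
          rw [one_div]
          refine inv_anti₀ (by norm_num) ?_
          have : (1 : ℝ) ≤ k := by exact_mod_cast hk
          push_cast; linarith
      _ ≤ γ := by
          rw [← Real.sqrt_eq_rpow, Real.sqrt_le_left hγ0.le]
          nlinarith
  have hH0 : (0 : ℝ) ≤ H := Nat.cast_nonneg _
  have hHk : ((H : ℝ) + 1) ^ k ≤ 2 ^ k * (2 * γ ^ (0.01 : ℝ)) := by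
    have h1 : (H : ℝ) + 1 ≤ 2 * ν := by
      have : (H : ℝ) ≤ ν := Nat.floor_le (by linarith)
      linarith
    have h2 : ν ^ k = (2 * γ) ^ (0.01 : ℝ) := by
      rw [hν, ← Real.rpow_natCast, ← Real.rpow_mul (by linarith)]
      congr 1
      have : (k : ℝ) ≠ 0 := by positivity
      push_cast
      field_simp
      norm_num
    calc ((H : ℝ) + 1) ^ k ≤ (2 * ν) ^ k := pow_le_pow_left₀ (by linarith) h1 k
      _ = 2 ^ k * (2 * γ) ^ (0.01 : ℝ) := by rw [mul_pow, h2]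
      _ ≤ _ := by
        rw [Real.mul_rpow (by norm_num) hγ0.le]
        gcongr
        calc (2 : ℝ) ^ (0.01 : ℝ) ≤ 2 ^ (1 : ℝ) := Real.rpow_le_rpow_of_exponent_le (by norm_num) (by norm_num)
          _ = 2 := Real.rpow_one 2
  set 𝒥 := Finset.powersetCard k (Finset.range (H + 1)) with h𝒥
  have h𝒥card : (𝒥.card : ℝ) ≤ 2 ^ k * (2 * γ ^ (0.01 : ℝ)) := by
    rw [h𝒥, Finset.card_powersetCard, Finset.card_range]
    refine le_trans ?_ hHk
    exact_mod_cast Nat.choose_le_pow (H + 1) k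
  have h𝒥mem : ∀ J ∈ 𝒥, J.card = k ∧ ∀ j ∈ J, j ≤ G := by
    intro J hJ
    obtain ⟨h1, h2⟩ := Finset.mem_powersetCard.1 hJ
    exact ⟨h2, fun j hj => by have := Finset.mem_range.1 (h1 hj); omega⟩
  have hgq : ∀ q : ℕ, X ≤ q → (q : ℝ) ≤ X + X ^ (0.01 : ℝ) →
      γ ≤ g q ∧ g q ≤ γ + C * γ ^ (0.99 : ℝ) := by
    intro q h1 h2
    refine ⟨hmono.monotone h1, ?_⟩
    have h3 := Convex.norm_image_sub_le_of_norm_deriv_le (𝕜 := ℝ) (f := g) (s := Set.Icc X (X + X ^ (0.01 : ℝ)))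
      (fun x _ => hdiff x) hder (convex_Icc _ _) (Set.left_mem_Icc.2 (by linarith)) ⟨h1, h2⟩
    rw [Real.norm_eq_abs, Real.norm_eq_abs, abs_of_nonneg (show 0 ≤ (q : ℝ) - X by linarith)] at h3
    have h4 := (le_abs_self _).trans h3
    have h5 : C * γ ^ (0.99 : ℝ) * X ^ (-0.01 : ℝ) * (q - X) ≤
        C * γ ^ (0.99 : ℝ) * X ^ (-0.01 : ℝ) * X ^ (0.01 : ℝ) := by
      refine mul_le_mul_of_nonneg_left (by linarith) ?_
      exact (abs_nonneg _).trans (hder X (Set.left_mem_Icc.2 (by linarith)))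
    have h6 : X ^ (-0.01 : ℝ) * X ^ (0.01 : ℝ) = 1 := by
      rw [← Real.rpow_add hX0]; norm_num
    have h7 : C * γ ^ (0.99 : ℝ) * X ^ (-0.01 : ℝ) * X ^ (0.01 : ℝ) = C * γ ^ (0.99 : ℝ) := by
      rw [mul_assoc, h6, mul_one]
    linarith
  set E := (shortWindow_finite (correlatedPrimes g k) 0.01 X).toFinset with hE
  have hEmem : ∀ p, p ∈ E ↔ p ∈ correlatedPrimes g k ∧ X ≤ p ∧ (p : ℝ) ≤ X + X ^ (0.01 : ℝ) := by
    intro p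
    rw [hE, Set.Finite.mem_toFinset]
    rfl
  have hmain := card_large_sums_le (T := γ ^ (0.995 : ℝ) / 2) (c := Cs * (G : ℝ) ^ (0.6 : ℝ))
    (L := (2 * γ) ^ k) (𝒥 := 𝒥) (E := E) hD2 hAB (by positivity) (by positivity)
    (fun J hJ => hsq J (h𝒥mem J hJ).1 G hG1 (h𝒥mem J hJ).2)
    (by
      intro J hJ m hm
      have h1 := shiftProd_le (Finset.mem_Icc.1 hm).2 (h𝒥mem J hJ).2
      rw [(h𝒥mem J hJ).1] at h1
      calc (shiftProd J m : ℝ) ≤ (2 * G : ℝ) ^ k := by exact_mod_cast h1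
        _ ≤ _ := by gcongr)
    (by
      intro p hp
      obtain ⟨-, h1, h2⟩ := (hEmem p).1 hp
      refine Finset.mem_Ioc.2 ⟨?_, Nat.le_floor h2⟩
      exact_mod_cast hAX'.trans_le h1)
    (by
      intro p hp
      obtain ⟨h0, h1, h2⟩ := (hEmem p).1 hp
      refine ⟨h0.1, ?_⟩
      have h3 : X ^ (0.0001 : ℝ) < X ^ (1 : ℝ) := Real.rpow_lt_rpow_of_exponent_lt hX1 (by norm_num)
      rw [Real.rpow_one] at h3
      exact_mod_cast (hDX.trans_lt h3).trans_le h1)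
    (by
      intro p hp
      obtain ⟨⟨hpp, J, hJk, hJg, hJs⟩, h1, h2⟩ := (hEmem p).1 hp
      obtain ⟨h3, h4⟩ := hgq p h1 h2
      refine ⟨J, ?_, ?_⟩
      · refine Finset.mem_powersetCard.2 ⟨fun j hj => Finset.mem_range.2 (Nat.lt_succ_of_le (Nat.le_floor ?_)), hJk⟩
        calc (j : ℝ) = ((j : ℝ) ^ (100 * k)) ^ ((100 * k : ℕ) : ℝ)⁻¹ :=
              (Real.pow_rpow_inv_natCast (Nat.cast_nonneg _) h100k).symm
          _ ≤ ν := by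
              refine Real.rpow_le_rpow (by positivity) ?_ (by positivity)
              have := hJg j hj
              linarith
      · have hle : G ≤ ⌊g p⌋₊ := Nat.floor_le_floor h3
        have hsplit : ∑ m ∈ Finset.Icc 1 ⌊g p⌋₊, (jacobiSym (shiftProd J m) p : ℝ)
            = ∑ m ∈ Finset.Icc 1 G, (jacobiSym (shiftProd J m) p : ℝ)
              + ∑ m ∈ Finset.Ioc G ⌊g p⌋₊, (jacobiSym (shiftProd J m) p : ℝ) := by
          rw [← Finset.sum_union]
          · congr 1
            ext m; simp only [Finset.mem_union, Finset.mem_Icc, Finset.mem_Ioc]; omega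
          · rw [Finset.disjoint_left]
            intro m hm hm'
            have := Finset.mem_Icc.1 hm
            have := Finset.mem_Ioc.1 hm'
            omega
        have htail : |∑ m ∈ Finset.Ioc G ⌊g p⌋₊, (jacobiSym (shiftProd J m) p : ℝ)|
            ≤ C * γ ^ (0.99 : ℝ) + 1 := by
          refine (Finset.abs_sum_le_sum_abs _ _).trans ?_
          have h5 : ∀ m ∈ Finset.Ioc G ⌊g p⌋₊, |(jacobiSym (shiftProd J m) p : ℝ)| ≤ 1 := by
            intro m _
            rcases jacobiSym.trichotomy (shiftProd J m) p with h | h | h <;> simp [h]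
          refine (Finset.sum_le_sum h5).trans ?_
          rw [Finset.sum_const, Nat.card_Ioc, nsmul_eq_mul, mul_one, Nat.cast_sub hle]
          have h6 : (⌊g p⌋₊ : ℝ) ≤ g p := Nat.floor_le (by linarith)
          have h7 := Nat.lt_floor_add_one γ
          rw [← hG] at h7
          linarith
        have h8 := abs_add_le (∑ m ∈ Finset.Icc 1 G, (jacobiSym (shiftProd J m) p : ℝ))
          (∑ m ∈ Finset.Ioc G ⌊g p⌋₊, (jacobiSym (shiftProd J m) p : ℝ))
        rw [← hsplit] at h8
        have h9 : γ ^ (0.995 : ℝ) ≤ g p ^ (0.995 : ℝ) := by gcongr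
        linarith)
  have hcardE : (shortWindow (correlatedPrimes g k) 0.01 X).ncard = E.card :=
    Set.ncard_eq_toFinset_card _ _
  rw [hcardE]
  have hD6 : (D : ℝ) ^ 6 ≤ X ^ (0.0006 : ℝ) := by
    calc (D : ℝ) ^ 6 ≤ (X ^ (0.0001 : ℝ)) ^ 6 := pow_le_pow_left₀ (by positivity) hDX 6
      _ = _ := by rw [← Real.rpow_natCast, ← Real.rpow_mul hX0.le]; norm_num
  have hF0 : 0 ≤ F := by positivity
  have hWb : ((B : ℝ) - A) * (2 / Real.log D) + (D : ℝ) ^ 6 ≤ 80001 * F := by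
    have h1 : ((B : ℝ) - A) ≤ 2 * X ^ (0.01 : ℝ) := by linarith
    have h2 : 2 / Real.log D ≤ 40000 / Real.log X := by
      have : 0 < Real.log D := by nlinarith
      rw [div_le_div_iff₀ this hlogX]
      linarith
    have h3 : (0 : ℝ) ≤ 2 / Real.log D := by
      have : 0 < Real.log D := by nlinarith
      positivity
    have h4 := mul_le_mul h1 h2 h3 (by positivity)
    have h5 : 2 * X ^ (0.01 : ℝ) * (40000 / Real.log X) = 80000 * F := by rw [hF]; ring
    linarith
  have hγX : γ ^ (0.02 : ℝ) ≤ X ^ (0.001 : ℝ) := by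
    refine le_trans ?_ hgX
    calc γ ^ (0.02 : ℝ) ≤ γ ^ (1 : ℝ) := Real.rpow_le_rpow_of_exponent_le (by linarith) (by norm_num)
      _ = γ := Real.rpow_one _
      _ ≤ (2 * γ) ^ 1 := by linarith
      _ ≤ _ := pow_le_pow_right₀ (by linarith) (by omega)
  have hGG : (G : ℝ) * (Cs * (G : ℝ) ^ (0.6 : ℝ)) ≤ Cs * γ ^ (1.6 : ℝ) := by
    calc (G : ℝ) * (Cs * (G : ℝ) ^ (0.6 : ℝ)) ≤ γ * (Cs * γ ^ (0.6 : ℝ)) := by gcongr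
      _ = Cs * (γ ^ (1 : ℝ) * γ ^ (0.6 : ℝ)) := by rw [Real.rpow_one]; ring
      _ = _ := by rw [← Real.rpow_add hγ0]; norm_num
  have hsecond : (G : ℝ) ^ 2 * ((D : ℝ) ^ 6 * (8 * ((2 * γ) ^ k) ^ 2))
      ≤ γ ^ (2 : ℝ) * (8 * X ^ (0.0016 : ℝ)) := by
    calc (G : ℝ) ^ 2 * ((D : ℝ) ^ 6 * (8 * ((2 * γ) ^ k) ^ 2))
        ≤ γ ^ 2 * (X ^ (0.0006 : ℝ) * (8 * X ^ (0.001 : ℝ))) := by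
          rw [← pow_mul, mul_comm k 2]
          gcongr
      _ = γ ^ (2 : ℝ) * (8 * (X ^ (0.0006 : ℝ) * X ^ (0.001 : ℝ))) := by
          rw [Real.rpow_two]; ring
      _ = _ := by rw [← Real.rpow_add hX0]; norm_num
  have hT2 : (γ ^ (0.995 : ℝ) / 2) ^ 2 = γ ^ (1.99 : ℝ) / 4 := by
    rw [div_pow, ← Real.rpow_natCast, ← Real.rpow_mul hγ0.le]
    norm_num
  rw [hT2] at hmain
  have hbound : (E.card : ℝ) * (γ ^ (1.99 : ℝ) / 4) ≤
      2 ^ k * (2 * γ ^ (0.01 : ℝ)) * (Cs * γ ^ (1.6 : ℝ) * (80001 * F) + γ ^ (2 : ℝ) * (8 * X ^ (0.0016 : ℝ))) := by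
    refine hmain.trans (mul_le_mul h𝒥card (add_le_add ?_ hsecond) ?_ (by positivity))
    · refine mul_le_mul hGG hWb ?_ (by positivity)
      have : (A : ℝ) ≤ B := by exact_mod_cast hAB
      have h3 : 0 < Real.log D := by nlinarith
      have : (0 : ℝ) ≤ (B - A) * (2 / Real.log D) := mul_nonneg (by linarith) (by positivity)
      positivity
    · have : (A : ℝ) ≤ B := by exact_mod_cast hAB
      have h3 : 0 < Real.log D := by nlinarith
      have : (0 : ℝ) ≤ (B - A) * (2 / Real.log D) := mul_nonneg (by linarith) (by positivity)
      positivity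
  have e1 : γ ^ (0.01 : ℝ) * γ ^ (1.6 : ℝ) = γ ^ (1.99 : ℝ) * γ ^ (-0.38 : ℝ) := by
    rw [← Real.rpow_add hγ0, ← Real.rpow_add hγ0]; norm_num
  have e2 : γ ^ (0.01 : ℝ) * γ ^ (2 : ℝ) = γ ^ (1.99 : ℝ) * γ ^ (0.02 : ℝ) := by
    rw [← Real.rpow_add hγ0, ← Real.rpow_add hγ0]; norm_num
  have e3 : γ ^ (0.02 : ℝ) * X ^ (0.0016 : ℝ) ≤ X ^ (0.0026 : ℝ) := by
    calc γ ^ (0.02 : ℝ) * X ^ (0.0016 : ℝ) ≤ X ^ (0.001 : ℝ) * X ^ (0.0016 : ℝ) := by gcongr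
      _ = _ := by rw [← Real.rpow_add hX0]; norm_num
  have hpos : 0 < γ ^ (1.99 : ℝ) / 4 := by positivity
  refine le_of_mul_le_mul_right (hbound.trans ?_) hpos
  have e4 : 2 ^ k * (2 * γ ^ (0.01 : ℝ)) * (Cs * γ ^ (1.6 : ℝ) * (80001 * F) + γ ^ (2 : ℝ) * (8 * X ^ (0.0016 : ℝ)))
      = 2 ^ k * 8 * (80001 * Cs * γ ^ (-0.38 : ℝ) * F + 8 * (γ ^ (0.02 : ℝ) * X ^ (0.0016 : ℝ))) * (γ ^ (1.99 : ℝ) / 4) := by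
    linear_combination (2 ^ k * 2 * Cs * (80001 * F)) * e1 + (2 ^ k * 2 * (8 * X ^ (0.0016 : ℝ))) * e2
  rw [e4]
  gcongr
theorem isLittleO_ncard_window_correlatedPrimes {g : ℝ → ℝ} (hmono : StrictMono g)
    (hdiff : Differentiable ℝ g) (hdiv : Tendsto g atTop atTop)
    (hderiv : ∃ C > 0, ∀ᶠ Q : ℝ in atTop, ∀ c ∈ Set.Icc Q (Q + Q ^ (0.01 : ℝ)),
      |deriv g c| ≤ C * g Q ^ (0.99 : ℝ) * Q ^ (-0.01 : ℝ))
    (hslow : ∀ ε : ℝ, 0 < ε → (fun Q : ℝ => g Q) =O[atTop] fun Q : ℝ => Q ^ ε)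
    {k : ℕ} (hk : 1 ≤ k) :
    (fun X : ℝ => ((shortWindow (correlatedPrimes g k) 0.01 X).ncard : ℝ))
      =o[atTop] fun X : ℝ => X ^ (0.01 : ℝ) / Real.log X := by
  obtain ⟨Cs, hCs, hsq⟩ := card_square_pairs_le hk
  obtain ⟨C, hC, hder⟩ := hderiv
  have hpow : ∀ a : ℝ, 0 < a → Tendsto (fun X : ℝ => X ^ a) atTop atTop := fun a ha => tendsto_rpow_atTop ha
  have hg2 : ∀ᶠ X in atTop, 2 ≤ g X := hdiv.eventually_ge_atTop 2
  have hCg : ∀ᶠ X in atTop, C * g X ^ (0.99 : ℝ) + 1 ≤ g X ^ (0.995 : ℝ) / 2 := by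
    filter_upwards [((hpow 0.005 (by norm_num)).comp hdiv).eventually_ge_atTop (2 * (C + 1)),
      hdiv.eventually_ge_atTop 1] with X h1 h2
    simp only [Function.comp_apply] at h1
    have h3 : g X ^ (0.995 : ℝ) = g X ^ (0.99 : ℝ) * g X ^ (0.005 : ℝ) := by
      rw [← Real.rpow_add (by linarith)]; norm_num
    have h4 : 1 ≤ g X ^ (0.99 : ℝ) := Real.one_le_rpow h2 (by norm_num)
    rw [h3]
    nlinarith [mul_le_mul_of_nonneg_left h1 (by linarith : 0 ≤ g X ^ (0.99 : ℝ))]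
  have hCg' : ∀ᶠ X in atTop, C * g X ^ (0.99 : ℝ) ≤ g X := by
    filter_upwards [hCg, hg2] with X h1 h2
    have h3 : g X ^ (0.995 : ℝ) ≤ g X ^ (1 : ℝ) :=
      Real.rpow_le_rpow_of_exponent_le (by linarith) (by norm_num)
    rw [Real.rpow_one] at h3
    have : 0 ≤ g X ^ (0.995 : ℝ) := by positivity
    linarith
  have hgX : ∀ᶠ X in atTop, (2 * g X) ^ (2 * k) ≤ X ^ (0.001 : ℝ) := by
    have hk0 : (0 : ℝ) < k := by exact_mod_cast hk
    obtain ⟨c, hc⟩ := (hslow (0.0001 / k) (by positivity)).bound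
    filter_upwards [hc, hg2, eventually_gt_atTop (0 : ℝ),
      (hpow (0.0008) (by norm_num)).eventually_ge_atTop ((2 * c) ^ (2 * k))] with X h1 h2 h3 h4
    rw [Real.norm_of_nonneg (by linarith), Real.norm_of_nonneg (by positivity)] at h1
    calc (2 * g X) ^ (2 * k) ≤ (2 * (c * X ^ (0.0001 / k : ℝ))) ^ (2 * k) := by gcongr
      _ = (2 * c) ^ (2 * k) * (X ^ (0.0001 / k : ℝ)) ^ (2 * k) := by rw [← mul_assoc, mul_pow]
      _ = (2 * c) ^ (2 * k) * X ^ (0.0002 : ℝ) := by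
          congr 1
          rw [← Real.rpow_natCast, ← Real.rpow_mul h3.le]
          congr 1
          push_cast
          field_simp
          norm_num
      _ ≤ X ^ (0.0008 : ℝ) * X ^ (0.0002 : ℝ) := by gcongr
      _ = _ := by rw [← Real.rpow_add h3]; norm_num
  have hlogo : ∀ a : ℝ, 0 < a → Tendsto (fun X : ℝ => Real.log X / X ^ a) atTop (𝓝 0) := fun a ha =>
    (isLittleO_log_rpow_atTop ha).tendsto_div_nhds_zero
  have hX6 : ∀ᶠ X : ℝ in atTop, X ^ (0.0006 : ℝ) ≤ X ^ (0.01 : ℝ) / Real.log X := by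
    filter_upwards [(hlogo 0.0094 (by norm_num)).eventually_le_const one_pos, eventually_gt_atTop (1 : ℝ)]
      with X h1 h2
    have h3 : X ^ (0.01 : ℝ) = X ^ (0.0006 : ℝ) * X ^ (0.0094 : ℝ) := by
      rw [← Real.rpow_add (by linarith)]; norm_num
    have h4 : 0 < X ^ (0.0094 : ℝ) := Real.rpow_pos_of_pos (by linarith) _
    rw [div_le_one h4] at h1
    rw [le_div_iff₀ (Real.log_pos h2), h3]
    exact mul_le_mul_of_nonneg_left h1 (Real.rpow_nonneg (by linarith) _)
  have hXlog : ∀ᶠ X : ℝ in atTop, Real.log 2 ≤ 0.00005 * Real.log X := by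
    filter_upwards [Real.tendsto_log_atTop.eventually_ge_atTop (Real.log 2 / 0.00005)] with X h1
    rw [div_le_iff₀ (by norm_num)] at h1
    linarith
  have hmajor : (fun X : ℝ => (2 : ℝ) ^ k * 8 * (80001 * Cs * g X ^ (-0.38 : ℝ) *
      (X ^ (0.01 : ℝ) / Real.log X) + 8 * X ^ (0.0026 : ℝ)))
      =o[atTop] fun X : ℝ => X ^ (0.01 : ℝ) / Real.log X := by
    refine IsLittleO.const_mul_left (IsLittleO.add ?_ (IsLittleO.const_mul_left ?_ _)) _
    · have h1 : (fun X : ℝ => 80001 * Cs * g X ^ (-0.38 : ℝ)) =o[atTop] fun _ : ℝ => (1 : ℝ) := by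
        rw [isLittleO_one_iff]
        have := ((tendsto_rpow_neg_atTop (y := 0.38) (by norm_num)).comp hdiv).const_mul (80001 * Cs)
        simpa using this
      simpa using h1.mul_isBigO (isBigO_refl (fun X : ℝ => X ^ (0.01 : ℝ) / Real.log X) atTop)
    · refine isLittleO_of_tendsto' ?_ ?_
      · filter_upwards [eventually_gt_atTop (1 : ℝ)] with X hX h0
        have := Real.log_pos hX
        have h2 : 0 < X ^ (0.01 : ℝ) / Real.log X := div_pos (Real.rpow_pos_of_pos (by linarith) _) this
        exact absurd h0 h2.ne'
      · refine (hlogo 0.0074 (by norm_num)).congr' ?_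
        filter_upwards [eventually_gt_atTop (1 : ℝ)] with X hX
        have h3 : X ^ (0.01 : ℝ) = X ^ (0.0026 : ℝ) * X ^ (0.0074 : ℝ) := by
          rw [← Real.rpow_add (by linarith)]; norm_num
        have h4 : 0 < X ^ (0.0074 : ℝ) := Real.rpow_pos_of_pos (by linarith) _
        have h5 : 0 < X ^ (0.0026 : ℝ) := Real.rpow_pos_of_pos (by linarith) _
        have := Real.log_pos hX
        rw [h3]
        field_simp
  refine IsBigO.trans_isLittleO (IsBigO.of_bound 1 ?_) hmajor
  filter_upwards [hder, hg2, hCg, hCg', hgX, eventually_gt_atTop (1 : ℝ),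
    (hpow 0.0001 (by norm_num)).eventually_ge_atTop 2, hXlog, hX6] with X h1 h2 h3 h4 h5 h6 h7 h8 h9
  rw [one_mul, Real.norm_of_nonneg (Nat.cast_nonneg _)]
  exact (ncard_window_correlatedPrimes_le hk hCs hsq hmono hdiff h1 h2 h3 h4 h5 h6 h7 h8 h9).trans
    (le_abs_self _)
theorem exists_diagonal_set {E : ℕ → Set ℕ}
    (hE : ∀ k, (fun X : ℝ => ((shortWindow (E k) 0.01 X).ncard : ℝ))
      =o[atTop] fun X : ℝ => X ^ (0.01 : ℝ) / Real.log X) :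
    ∃ E' : Set ℕ, (fun X : ℝ => ((shortWindow E' 0.01 X).ncard : ℝ))
      =o[atTop] (fun X : ℝ => X ^ (0.01 : ℝ) / Real.log X) ∧
      ∀ k, ∃ N, ∀ q ∈ E k, N ≤ q → q ∈ E' := by
  have hsum : ∀ K : ℕ, ∃ N : ℕ, ∀ X : ℝ, (N : ℝ) ≤ X →
      ∑ i ∈ Finset.range (K + 1), ((shortWindow (E i) 0.01 X).ncard : ℝ)
        ≤ 1 / ((K : ℝ) + 1) * ‖X ^ (0.01 : ℝ) / Real.log X‖ := by
    intro K
    have h1 := (IsLittleO.sum (s := Finset.range (K + 1)) fun i _ => hE i).def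
      (show (0 : ℝ) < 1 / ((K : ℝ) + 1) by positivity)
    obtain ⟨a, ha⟩ := eventually_atTop.1 h1
    obtain ⟨N, hN⟩ := exists_nat_ge a
    exact ⟨N, fun X hX => (le_abs_self _).trans (by simpa using ha X (hN.trans hX))⟩
  choose N hN using hsum
  refine ⟨{q | ∃ k, q ∈ E k ∧ 2 * (N k + k) ≤ q}, ?_, fun k => ⟨2 * (N k + k), fun q hq h => ⟨k, hq, h⟩⟩⟩
  refine isLittleO_iff.2 fun ε hε => ?_
  obtain ⟨K₀, hK₀⟩ := exists_nat_one_div_lt hε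
  filter_upwards [eventually_ge_atTop ((N K₀ + K₀ : ℕ) : ℝ), eventually_ge_atTop (1 : ℝ)] with X hX hX1
  have hX0 : 0 ≤ X := by linarith
  set P : ℕ → Prop := fun k => N k + k ≤ ⌊X⌋₊ with hP
  set K := Nat.findGreatest P ⌊X⌋₊ with hK
  have hle : ∀ k, P k → k ≤ K := fun k hk => Nat.le_findGreatest (by simp only [hP] at hk; omega) hk
  have hPK₀ : P K₀ := Nat.le_floor hX
  have hPK : P K := Nat.findGreatest_spec (m := K₀) (by simp only [hP] at hPK₀; omega) hPK₀
  have hKX : (N K : ℝ) ≤ X := by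
    have h1 : N K ≤ ⌊X⌋₊ := by simp only [hP] at hPK; omega
    exact (by exact_mod_cast h1 : (N K : ℝ) ≤ ⌊X⌋₊).trans (Nat.floor_le hX0)
  have hpow : X ^ (0.01 : ℝ) ≤ X := by
    calc X ^ (0.01 : ℝ) ≤ X ^ (1 : ℝ) := Real.rpow_le_rpow_of_exponent_le hX1 (by norm_num)
      _ = X := Real.rpow_one X
  have hsub : shortWindow {q | ∃ k, q ∈ E k ∧ 2 * (N k + k) ≤ q} 0.01 X
      ⊆ ⋃ i ∈ Finset.range (K + 1), shortWindow (E i) 0.01 X := by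
    rintro q ⟨⟨k, hk, hkq⟩, h1, h2⟩
    have h3 : P k := by
      refine Nat.le_floor ?_
      have : ((2 * (N k + k) : ℕ) : ℝ) ≤ q := by exact_mod_cast hkq
      push_cast at this ⊢
      linarith
    exact Set.mem_biUnion (Finset.mem_coe.2 (Finset.mem_range.2 (Nat.lt_succ_of_le (hle k h3)))) ⟨hk, h1, h2⟩
  have hcard : (shortWindow {q | ∃ k, q ∈ E k ∧ 2 * (N k + k) ≤ q} 0.01 X).ncard
      ≤ ∑ i ∈ Finset.range (K + 1), (shortWindow (E i) 0.01 X).ncard :=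
    (Set.ncard_le_ncard hsub (Set.Finite.biUnion (Finset.finite_toSet _)
      fun i _ => shortWindow_finite _ _ _)).trans (Finset.set_ncard_biUnion_le _ _)
  have hcard' : ((shortWindow {q | ∃ k, q ∈ E k ∧ 2 * (N k + k) ≤ q} 0.01 X).ncard : ℝ)
      ≤ ∑ i ∈ Finset.range (K + 1), ((shortWindow (E i) 0.01 X).ncard : ℝ) := by exact_mod_cast hcard
  rw [Real.norm_of_nonneg (Nat.cast_nonneg _)]
  refine (hcard'.trans (hN K X hKX)).trans (mul_le_mul_of_nonneg_right ?_ (norm_nonneg _))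
  refine le_trans ?_ hK₀.le
  have : (K₀ : ℝ) ≤ K := by exact_mod_cast hle K₀ hPK₀
  gcongr

theorem ncard_shortWindow_le {E : Set ℕ} {η X ε : ℝ} (hη : 0.01 ≤ η) (hη1 : η ≤ 1) (hX : 1 < X)
    (hε : 0 ≤ ε)
    (h : ∀ Y : ℝ, X ≤ Y → ((shortWindow E 0.01 Y).ncard : ℝ) ≤ ε * (Y ^ (0.01 : ℝ) / Real.log Y)) :
    ((shortWindow E η X).ncard : ℝ) ≤ 6 * ε * (X ^ η / Real.log X) := by
  have hX0 : 0 < X := by linarith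
  have hlog : 0 < Real.log X := Real.log_pos hX
  set Y := X ^ (0.01 : ℝ) with hY
  have hY0 : 0 < Y := by positivity
  set n := ⌊X ^ η / Y⌋₊ with hn
  have hηX : X ^ η ≤ X := by
    calc X ^ η ≤ X ^ (1 : ℝ) := Real.rpow_le_rpow_of_exponent_le hX.le hη1
      _ = X := Real.rpow_one X
  have hYη : Y ≤ X ^ η := Real.rpow_le_rpow_of_exponent_le hX.le hη
  have hnY : (n : ℝ) * Y ≤ X ^ η := by
    rw [← le_div_iff₀ hY0]
    exact Nat.floor_le (by positivity)
  have hsub : shortWindow E η X ⊆ ⋃ i ∈ Finset.range (n + 1), shortWindow E 0.01 (X + i * Y) := by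
    rintro q ⟨hq, h1, h2⟩
    have h3 : 0 ≤ ((q : ℝ) - X) / Y := div_nonneg (by linarith) hY0.le
    refine Set.mem_biUnion (x := ⌊((q : ℝ) - X) / Y⌋₊) (Finset.mem_coe.2 (Finset.mem_range.2 (Nat.lt_succ_of_le ?_))) ⟨hq, ?_, ?_⟩
    · exact Nat.floor_le_floor (by gcongr; linarith)
    · have := Nat.floor_le h3
      rw [le_div_iff₀ hY0] at this
      linarith
    · have := Nat.lt_floor_add_one (((q : ℝ) - X) / Y)
      rw [div_lt_iff₀ hY0] at this
      set i := ⌊((q : ℝ) - X) / Y⌋₊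
      have h4 : Y ≤ (X + i * Y) ^ (0.01 : ℝ) := by
        have : 0 ≤ (i : ℝ) * Y := by positivity
        exact Real.rpow_le_rpow hX0.le (by linarith) (by norm_num)
      linarith
  have hcard : (shortWindow E η X).ncard ≤ ∑ i ∈ Finset.range (n + 1), (shortWindow E 0.01 (X + i * Y)).ncard :=
    (Set.ncard_le_ncard hsub (Set.Finite.biUnion (Finset.finite_toSet _)
      fun i _ => shortWindow_finite _ _ _)).trans (Finset.set_ncard_biUnion_le _ _)
  have hcard' : ((shortWindow E η X).ncard : ℝ)
      ≤ ∑ i ∈ Finset.range (n + 1), ((shortWindow E 0.01 (X + i * Y)).ncard : ℝ) := by exact_mod_cast hcard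
  refine hcard'.trans ?_
  have hterm : ∀ i ∈ Finset.range (n + 1), ((shortWindow E 0.01 (X + i * Y)).ncard : ℝ)
      ≤ ε * (3 * Y / Real.log X) := by
    intro i hi
    have hi' : (i : ℝ) ≤ n := by exact_mod_cast Nat.lt_succ_iff.1 (Finset.mem_range.1 hi)
    have h1 : 0 ≤ (i : ℝ) * Y := by positivity
    have h2 : (i : ℝ) * Y ≤ X := (mul_le_mul_of_nonneg_right hi' hY0.le).trans (hnY.trans hηX)
    refine (h _ (by linarith)).trans (mul_le_mul_of_nonneg_left ?_ hε)
    have h3 : (X + i * Y) ^ (0.01 : ℝ) ≤ 3 * Y := by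
      calc (X + i * Y) ^ (0.01 : ℝ) ≤ (3 * X) ^ (0.01 : ℝ) := by gcongr; linarith
        _ = 3 ^ (0.01 : ℝ) * Y := Real.mul_rpow (by norm_num) hX0.le
        _ ≤ 3 ^ (1 : ℝ) * Y := by
            gcongr
            · norm_num
            · norm_num
        _ = 3 * Y := by rw [Real.rpow_one]
    have h4 : Real.log X ≤ Real.log (X + i * Y) := Real.log_le_log hX0 (by linarith)
    gcongr
  refine (Finset.sum_le_sum hterm).trans ?_
  rw [Finset.sum_const, Finset.card_range, nsmul_eq_mul]
  push_cast
  have h5 : ((n : ℝ) + 1) * Y ≤ 2 * X ^ η := by linarith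
  calc ((n : ℝ) + 1) * (ε * (3 * Y / Real.log X)) = 3 * ε / Real.log X * (((n : ℝ) + 1) * Y) := by ring
    _ ≤ 3 * ε / Real.log X * (2 * X ^ η) := by gcongr
    _ = _ := by ring

theorem isLittleO_ncard_shortWindow {E : Set ℕ} {η : ℝ} (hη : 0.01 ≤ η) (hη1 : η ≤ 1)
    (hE : (fun X : ℝ => ((shortWindow E 0.01 X).ncard : ℝ))
      =o[atTop] fun X : ℝ => X ^ (0.01 : ℝ) / Real.log X) :
    (fun X : ℝ => ((shortWindow E η X).ncard : ℝ)) =o[atTop] fun X : ℝ => X ^ η / Real.log X := by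
  refine isLittleO_iff.2 fun ε hε => ?_
  obtain ⟨a, ha⟩ := eventually_atTop.1 (hE.def (show 0 < ε / 6 by positivity))
  filter_upwards [eventually_ge_atTop a, eventually_gt_atTop (1 : ℝ)] with X hXa hX
  have h1 := ncard_shortWindow_le (ε := ε / 6) (E := E) hη hη1 hX (by positivity) fun Y hY => by
    have h2 := ha Y (hXa.trans hY)
    have h3 : 0 < Real.log Y := Real.log_pos (by linarith)
    have h4 : 0 ≤ Y ^ (0.01 : ℝ) / Real.log Y := div_nonneg (Real.rpow_nonneg (by linarith) _) h3.le
    rwa [Real.norm_of_nonneg (Nat.cast_nonneg _), Real.norm_of_nonneg h4] at h2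
  rw [Real.norm_of_nonneg (Nat.cast_nonneg _)]
  refine h1.trans (le_trans (le_of_eq (by ring)) (mul_le_mul_of_nonneg_left (le_abs_self _) hε.le))

theorem exists_sufficient_set {g : ℝ → ℝ} (hmono : StrictMono g)
    (hdiff : Differentiable ℝ g) (hdiv : Tendsto g atTop atTop)
    (hderiv : ∃ C > 0, ∀ᶠ Q : ℝ in atTop, ∀ c ∈ Set.Icc Q (Q + Q ^ (0.01 : ℝ)),
      |deriv g c| ≤ C * g Q ^ (0.99 : ℝ) * Q ^ (-0.01 : ℝ))
    (hslow : ∀ ε : ℝ, 0 < ε → (fun Q : ℝ => g Q) =O[atTop] fun Q : ℝ => Q ^ ε) :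
    ∃ B : Set ℕ, B ⊆ {p : ℕ | p.Prime} ∧ (∀ η ∈ Set.Icc (0.01 : ℝ) 1, EtaSufficient η B) ∧
      ∀ k, 1 ≤ k → ∃ N, ∀ q ∈ B, N ≤ q → q ∉ correlatedPrimes g k := by
  obtain ⟨E, hE, hmem⟩ := exists_diagonal_set (E := fun k => correlatedPrimes g (k + 1)) fun k =>
    isLittleO_ncard_window_correlatedPrimes hmono hdiff hdiv hderiv hslow (Nat.le_add_left 1 k)
  refine ⟨{p | p.Prime ∧ p ∉ E}, fun p hp => hp.1, fun η hη => ?_, fun k hk => ?_⟩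
  · refine IsBigO.trans_isLittleO (IsBigO.of_bound 1 (Eventually.of_forall fun X => ?_))
      (isLittleO_ncard_shortWindow hη.1 hη.2 hE)
    rw [one_mul, Real.norm_of_nonneg (Nat.cast_nonneg _), Real.norm_of_nonneg (Nat.cast_nonneg _)]
    refine Nat.cast_le.2 (Set.ncard_le_ncard ?_ (shortWindow_finite _ _ _))
    rintro p ⟨hp, hpB, h1, h2⟩
    exact ⟨by_contra fun h => hpB ⟨hp, h⟩, h1, h2⟩
  · obtain ⟨N, hN⟩ := hmem (k - 1)
    refine ⟨N, fun q hq hNq hc => hq.2 (hN q ?_ hNq)⟩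
    rwa [Nat.sub_add_cancel hk]
theorem norm_exp_sub_taylor_le_of_re_eq_zero {z : ℂ} (hre : z.re = 0) (hz : ‖z‖ ≤ 1) (R : ℕ) {x : ℝ}
    (hx : 0 ≤ x) :
    ‖Complex.exp (z * x) - ∑ r ∈ Finset.range R, (z * x) ^ r / r.factorial‖ ≤ x ^ R / R.factorial := by
  induction R generalizing x with
  | zero => simp [Complex.norm_exp, hre]
  | succ R ih =>
    have hf : ∀ y : ℝ, HasDerivAt (fun y : ℝ => Complex.exp (z * y)
        - ∑ r ∈ Finset.range (R + 1), (z * y) ^ r / r.factorial)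
        (z * (Complex.exp (z * y) - ∑ r ∈ Finset.range R, (z * y) ^ r / r.factorial)) y := by
      intro y
      have h0 : HasDerivAt (fun y : ℝ => z * (y : ℂ)) z y := by
        simpa using (Complex.ofRealCLM.hasDerivAt (x := y)).const_mul z
      have h1 : HasDerivAt (fun y : ℝ => ∑ r ∈ Finset.range (R + 1), (z * (y : ℂ)) ^ r / (r.factorial : ℂ))
          (∑ r ∈ Finset.range (R + 1), (r : ℂ) * (z * y) ^ (r - 1) * z / r.factorial) y :=
        HasDerivAt.fun_sum fun r _ => (h0.pow r).div_const _
      refine (h0.cexp.sub h1).congr_deriv ?_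
      rw [Finset.sum_range_succ', mul_sub, Finset.mul_sum]
      congr 1
      · ring
      · simp only [Nat.cast_zero, zero_mul, zero_div, add_zero]
        refine Finset.sum_congr rfl fun r _ => ?_
        rw [Nat.factorial_succ]
        have h2 : (r.factorial : ℂ) ≠ 0 := by exact_mod_cast r.factorial_ne_zero
        have h3 : (r : ℂ) + 1 ≠ 0 := by exact_mod_cast r.succ_ne_zero
        push_cast
        field_simp
    have hB : ∀ y : ℝ, HasDerivAt (fun y : ℝ => y ^ (R + 1) / ((R + 1).factorial : ℝ))
        (y ^ R / R.factorial) y := by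
      intro y
      refine ((hasDerivAt_pow (R + 1) y).div_const _).congr_deriv ?_
      rw [Nat.factorial_succ]
      have h2 : (R.factorial : ℝ) ≠ 0 := by exact_mod_cast R.factorial_ne_zero
      push_cast
      field_simp
    refine image_norm_le_of_norm_deriv_right_le_deriv_boundary (a := 0) (b := x)
      (fun y _ => (hf y).continuousAt.continuousWithinAt) (fun y _ => (hf y).hasDerivWithinAt)
      ?_ hB (fun y hy => ?_) ⟨hx, le_rfl⟩
    · simp [Finset.sum_range_succ']
    · rw [norm_mul]
      exact (mul_le_of_le_one_left (norm_nonneg _) hz).trans (ih hy.1)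

theorem norm_exp_mul_I_sub_taylor_le (R : ℕ) (x : ℝ) :
    ‖Complex.exp (x * Complex.I) - ∑ r ∈ Finset.range R, (x * Complex.I) ^ r / r.factorial‖
      ≤ |x| ^ R / R.factorial := by
  rcases le_total 0 x with hx | hx
  · have := norm_exp_sub_taylor_le_of_re_eq_zero (z := Complex.I) (by simp) (by simp) R hx
    rw [abs_of_nonneg hx]
    simpa only [mul_comm] using this
  · have := norm_exp_sub_taylor_le_of_re_eq_zero (z := -Complex.I) (by simp) (by simp) R (neg_nonneg.2 hx)
    rw [abs_of_nonpos hx]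
    simpa only [Complex.ofReal_neg, neg_mul_neg, mul_comm] using this
section Moments

open scoped BigOperators

theorem exists_toggle {ι : Type*} (J₀ J : Finset ι) (hJ : J ⊆ J₀) {j : ι} (hj : j ∈ J₀) :
    ∃ J' ⊆ J₀, J'.card ≤ J.card + 1 ∧
      ∀ a : ι → ℝ, a j ^ 2 = 1 → a j * ∏ i ∈ J, a i = ∏ i ∈ J', a i := by
  by_cases h : j ∈ J
  · refine ⟨J.erase j, (Finset.erase_subset _ _).trans hJ, (Finset.card_erase_le).trans (Nat.le_succ _), fun a ha => ?_⟩
    rw [← Finset.mul_prod_erase J a h, ← mul_assoc, ← sq, ha, one_mul]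
  · exact ⟨insert j J, Finset.insert_subset hj hJ, Finset.card_insert_le _ _,
      fun a _ => (Finset.prod_insert h).symm⟩

theorem expect_pow_succ_sum_mul_prod {γ ι : Type*} {u : Finset γ} {J₀ J : Finset ι} {T : ι → Finset ι}
    (hT : ∀ j ∈ J₀, ∀ a : ι → ℝ, a j ^ 2 = 1 → a j * ∏ i ∈ J, a i = ∏ i ∈ T j, a i)
    {c : γ → ι → ℝ} (hc : ∀ x ∈ u, ∀ j ∈ J₀, c x j ^ 2 = 1) {r : ℕ} :
    (𝔼 x ∈ u, (∑ j ∈ J₀, c x j) ^ (r + 1) * ∏ j ∈ J, c x j)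
      = ∑ j ∈ J₀, 𝔼 x ∈ u, (∑ i ∈ J₀, c x i) ^ r * ∏ i ∈ T j, c x i := by
  rw [← Finset.expect_sum_comm]
  refine Finset.expect_congr rfl fun x hx => ?_
  rw [pow_succ, mul_assoc, Finset.sum_mul, Finset.mul_sum]
  exact Finset.sum_congr rfl fun j hj => by rw [hT j hj _ (hc x hx j hj)]

theorem abs_expect_pow_sum_sub_le {α β ι : Type*} {s : Finset α} {t : Finset β} {J₀ : Finset ι}
    {a : α → ι → ℝ} {b : β → ι → ℝ} (ha : ∀ x ∈ s, ∀ j ∈ J₀, a x j ^ 2 = 1)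
    (hb : ∀ y ∈ t, ∀ j ∈ J₀, b y j ^ 2 = 1) {R : ℕ} {δ : ℝ}
    (hcorr : ∀ J ⊆ J₀, J.card ≤ R →
      |(𝔼 x ∈ s, ∏ j ∈ J, a x j) - 𝔼 y ∈ t, ∏ j ∈ J, b y j| ≤ δ) {r : ℕ} :
    ∀ J ⊆ J₀, J.card + r ≤ R →
      |(𝔼 x ∈ s, (∑ j ∈ J₀, a x j) ^ r * ∏ j ∈ J, a x j)
        - 𝔼 y ∈ t, (∑ j ∈ J₀, b y j) ^ r * ∏ j ∈ J, b y j| ≤ (J₀.card : ℝ) ^ r * δ := by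
  induction r with
  | zero => intro J hJ hJR; simpa using hcorr J hJ hJR
  | succ r ih =>
    intro J hJ hJR
    choose! T hT hTcard hTprod using fun j (hj : j ∈ J₀) => exists_toggle J₀ J hJ hj
    rw [expect_pow_succ_sum_mul_prod hTprod ha, expect_pow_succ_sum_mul_prod hTprod hb, ← Finset.sum_sub_distrib]
    refine (Finset.abs_sum_le_sum_abs _ _).trans ?_
    refine (Finset.sum_le_sum fun j hj => ih (T j) (hT j hj) (by have := hTcard j hj; omega)).trans ?_
    rw [Finset.sum_const, nsmul_eq_mul, pow_succ]
    exact le_of_eq (by ring)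

/-- The Rademacher sign attached to `j` by the subset `A`. -/
def subsetSign {ι : Type*} (A : Finset ι) (j : ι) : ℝ := if j ∈ A then 1 else -1

theorem subsetSign_sq {ι : Type*} (A : Finset ι) (j : ι) : subsetSign A j ^ 2 = 1 := by
  unfold subsetSign; split_ifs <;> norm_num

theorem expect_prod_subsetSign {ι K : Type*} [Field K] [CharZero K] (J₀ : Finset ι) (φ : ι → ℝ → K) :
    𝔼 A ∈ J₀.powerset, ∏ j ∈ J₀, φ j (subsetSign A j) = ∏ j ∈ J₀, ((φ j 1 + φ j (-1)) / 2) := by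
  have h1 : ∑ A ∈ J₀.powerset, ∏ j ∈ J₀, φ j (subsetSign A j) = ∏ j ∈ J₀, (φ j 1 + φ j (-1)) := by
    rw [Finset.prod_add]
    refine Finset.sum_congr rfl fun A hA => ?_
    rw [← Finset.prod_sdiff (Finset.mem_powerset.1 hA), mul_comm]
    congr 1
    · exact Finset.prod_congr rfl fun j hj => by simp [subsetSign, hj]
    · exact Finset.prod_congr rfl fun j hj => by simp [subsetSign, (Finset.mem_sdiff.1 hj).2]
  rw [Finset.expect_eq_sum_div_card, h1, Finset.card_powerset, Finset.prod_div_distrib, Finset.prod_const]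
  push_cast
  rfl

theorem expect_prod_subsetSign_subset {ι : Type*} {J₀ J : Finset ι} (hJ : J ⊆ J₀) (hne : J.Nonempty) :
    𝔼 A ∈ J₀.powerset, ∏ j ∈ J, subsetSign A j = 0 := by
  have h1 := expect_prod_subsetSign J₀ (fun j x => if j ∈ J then x else 1)
  obtain ⟨i, hi⟩ := hne
  rw [Finset.prod_eq_zero (hJ hi) (by simp [hi])] at h1
  rw [← h1]
  refine Finset.expect_congr rfl fun A _ => ?_
  rw [Finset.prod_ite_mem, Finset.inter_eq_right.2 hJ]

theorem expect_exp_subsetSign {ι : Type*} (J₀ : Finset ι) (v : ℝ) :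
    𝔼 A ∈ J₀.powerset, Real.exp (v * ∑ j ∈ J₀, subsetSign A j) = Real.cosh v ^ J₀.card := by
  have h1 := expect_prod_subsetSign J₀ (fun _ x => Real.exp (v * x))
  rw [Finset.prod_const] at h1
  rw [Real.cosh_eq]
  simp only [mul_one, mul_neg] at h1
  rw [← h1]
  refine Finset.expect_congr rfl fun A _ => ?_
  rw [Finset.mul_sum, Real.exp_sum]

theorem expect_cexp_subsetSign {ι : Type*} (J₀ : Finset ι) (v : ℝ) :
    𝔼 A ∈ J₀.powerset, Complex.exp (((v * ∑ j ∈ J₀, subsetSign A j : ℝ) : ℂ) * Complex.I)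
      = ((Real.cos v ^ J₀.card : ℝ) : ℂ) := by
  have h1 := expect_prod_subsetSign J₀ (fun _ x => Complex.exp ((v * x : ℝ) * Complex.I))
  rw [Finset.prod_const] at h1
  push_cast
  rw [Complex.cos]
  simp only [mul_one, mul_neg, Complex.ofReal_neg, neg_mul] at h1
  rw [neg_mul, ← h1]
  refine Finset.expect_congr rfl fun A _ => ?_
  rw [← Complex.exp_sum, Finset.mul_sum, Finset.sum_mul]
  push_cast
  rfl

theorem expect_even_pow_subsetSign_le {ι : Type*} (J₀ : Finset ι) (u : ℝ) {R : ℕ} (hR : Even R) :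
    𝔼 A ∈ J₀.powerset, (u * ∑ j ∈ J₀, subsetSign A j) ^ R / R.factorial
      ≤ 2 / 2 ^ R * Real.exp (2 * u ^ 2 * J₀.card) := by
  have hpt : ∀ y : ℝ, y ^ R / R.factorial ≤ 1 / 2 ^ R * (Real.exp (2 * y) + Real.exp (-(2 * y))) := by
    intro y
    have h1 := Real.pow_div_factorial_le_exp |2 * y| (abs_nonneg _) R
    rw [hR.pow_abs, mul_pow] at h1
    have h2 : Real.exp |2 * y| ≤ Real.exp (2 * y) + Real.exp (-(2 * y)) := by
      rcases abs_choice (2 * y) with h | h <;> rw [h]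
      · linarith [Real.exp_pos (-(2 * y))]
      · linarith [Real.exp_pos (2 * y)]
    have h3 : y ^ R / R.factorial = 1 / 2 ^ R * (2 ^ R * y ^ R / R.factorial) := by field_simp
    rw [h3]
    exact mul_le_mul_of_nonneg_left (h1.trans h2) (by positivity)
  have hcosh : Real.cosh (2 * u) ^ J₀.card ≤ Real.exp (2 * u ^ 2 * J₀.card) := by
    calc Real.cosh (2 * u) ^ J₀.card ≤ Real.exp ((2 * u) ^ 2 / 2) ^ J₀.card :=
          pow_le_pow_left₀ (Real.cosh_pos _).le (Real.cosh_le_exp_half_sq _) _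
      _ = _ := by rw [← Real.exp_nat_mul]; congr 1; ring
  refine (Finset.expect_le_expect fun A _ => hpt _).trans ?_
  rw [← Finset.mul_expect, Finset.expect_add_distrib]
  have h1 := expect_exp_subsetSign J₀ (2 * u)
  have h2 := expect_exp_subsetSign J₀ (-(2 * u))
  rw [Real.cosh_neg] at h2
  have h3 : (𝔼 A ∈ J₀.powerset, Real.exp (2 * (u * ∑ j ∈ J₀, subsetSign A j))) = Real.cosh (2 * u) ^ J₀.card := by
    rw [← h1]; exact Finset.expect_congr rfl fun A _ => by rw [mul_assoc]
  have h4 : (𝔼 A ∈ J₀.powerset, Real.exp (-(2 * (u * ∑ j ∈ J₀, subsetSign A j)))) = Real.cosh (2 * u) ^ J₀.card := by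
    rw [← h2]; exact Finset.expect_congr rfl fun A _ => by congr 1; ring
  rw [h3, h4]
  calc 1 / 2 ^ R * (Real.cosh (2 * u) ^ J₀.card + Real.cosh (2 * u) ^ J₀.card)
      = 2 / 2 ^ R * Real.cosh (2 * u) ^ J₀.card := by ring
    _ ≤ _ := by gcongr

end Moments
section CharFun

open scoped BigOperators

theorem expect_taylor_eq {α : Type*} (s : Finset α) (X : α → ℝ) (R : ℕ) :
    (𝔼 x ∈ s, ∑ r ∈ Finset.range R, ((X x : ℂ) * Complex.I) ^ r / r.factorial)
      = ∑ r ∈ Finset.range R, ((𝔼 x ∈ s, X x ^ r : ℝ) : ℂ) * (Complex.I ^ r / r.factorial) := by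
  rw [Finset.expect_sum_comm]
  refine Finset.sum_congr rfl fun r _ => ?_
  rw [Complex.ofReal_expect, Finset.expect_mul]
  refine Finset.expect_congr rfl fun x _ => ?_
  push_cast
  ring

theorem norm_expect_cexp_sub_taylor_le {α : Type*} (s : Finset α) (X : α → ℝ) {R : ℕ} (hR : Even R) :
    ‖(𝔼 x ∈ s, Complex.exp (X x * Complex.I))
      - ∑ r ∈ Finset.range R, ((𝔼 x ∈ s, X x ^ r : ℝ) : ℂ) * (Complex.I ^ r / r.factorial)‖
      ≤ 𝔼 x ∈ s, X x ^ R / R.factorial := by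
  rw [← expect_taylor_eq, ← Finset.expect_sub_distrib]
  refine (RCLike.norm_expect_le (K := ℂ)).trans (Finset.expect_le_expect fun x _ => ?_)
  have := norm_exp_mul_I_sub_taylor_le R (X x)
  rwa [hR.pow_abs] at this

theorem norm_expect_cexp_sub_cos_pow_le {α ι : Type*} {s : Finset α} (hs : s.Nonempty) {J₀ : Finset ι}
    {a : α → ι → ℝ} (ha : ∀ x ∈ s, ∀ j ∈ J₀, a x j ^ 2 = 1) {R : ℕ} (hR : Even R) {δ : ℝ} (hδ : 0 ≤ δ)
    (hcorr : ∀ J ⊆ J₀, J.Nonempty → J.card ≤ R → |𝔼 x ∈ s, ∏ j ∈ J, a x j| ≤ δ) (u : ℝ) :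
    ‖(𝔼 x ∈ s, Complex.exp (((u * ∑ j ∈ J₀, a x j : ℝ) : ℂ) * Complex.I))
        - ((Real.cos u ^ J₀.card : ℝ) : ℂ)‖
      ≤ δ * (∑ r ∈ Finset.range (R + 1), (|u| * J₀.card) ^ r / r.factorial)
        + 4 / 2 ^ R * Real.exp (2 * u ^ 2 * J₀.card) := by
  set X : α → ℝ := fun x => u * ∑ j ∈ J₀, a x j with hX
  set Y : Finset ι → ℝ := fun A => u * ∑ j ∈ J₀, subsetSign A j with hY
  have hpne : J₀.powerset.Nonempty := ⟨∅, Finset.empty_mem_powerset _⟩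
  have hmom : ∀ r ≤ R, |(𝔼 x ∈ s, X x ^ r) - 𝔼 A ∈ J₀.powerset, Y A ^ r| ≤ (|u| * J₀.card) ^ r * δ := by
    intro r hr
    have h1 := abs_expect_pow_sum_sub_le (t := J₀.powerset) (b := subsetSign) (δ := δ) ha
      (fun A _ j _ => subsetSign_sq A j) (fun J hJ hJR => by
        rcases J.eq_empty_or_nonempty with rfl | hne
        · simpa [Finset.expect_const hs, Finset.expect_const hpne] using hδ
        · rw [expect_prod_subsetSign_subset hJ hne, sub_zero]
          exact hcorr J hJ hne hJR) ∅ (Finset.empty_subset _) (by simpa using hr)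
    simp only [Finset.prod_empty, mul_one] at h1
    simp only [hX, hY, mul_pow]
    rw [← Finset.mul_expect, ← Finset.mul_expect, ← mul_sub, abs_mul, abs_pow, mul_assoc]
    exact mul_le_mul_of_nonneg_left h1 (by positivity)
  have hYc : (𝔼 A ∈ J₀.powerset, Complex.exp ((Y A : ℂ) * Complex.I)) = ((Real.cos u ^ J₀.card : ℝ) : ℂ) :=
    expect_cexp_subsetSign J₀ u
  rw [← hYc]
  have hXt := norm_expect_cexp_sub_taylor_le s X hR
  have hYt := norm_expect_cexp_sub_taylor_le J₀.powerset Y hR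
  have hYm : 𝔼 A ∈ J₀.powerset, Y A ^ R / R.factorial ≤ 2 / 2 ^ R * Real.exp (2 * u ^ 2 * J₀.card) :=
    expect_even_pow_subsetSign_le J₀ u hR
  have hXm : 𝔼 x ∈ s, X x ^ R / R.factorial ≤
      (𝔼 A ∈ J₀.powerset, Y A ^ R / R.factorial) + δ * ((|u| * J₀.card) ^ R / R.factorial) := by
    have h1 := (abs_le.1 (hmom R le_rfl)).2
    rw [← Finset.expect_div, ← Finset.expect_div]
    calc (𝔼 x ∈ s, X x ^ R) / (R.factorial : ℝ)
        ≤ ((𝔼 A ∈ J₀.powerset, Y A ^ R) + (|u| * J₀.card) ^ R * δ) / R.factorial := by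
          gcongr; linarith
      _ = _ := by ring
  have hP : ‖(∑ r ∈ Finset.range R, ((𝔼 x ∈ s, X x ^ r : ℝ) : ℂ) * (Complex.I ^ r / r.factorial))
      - ∑ r ∈ Finset.range R, ((𝔼 A ∈ J₀.powerset, Y A ^ r : ℝ) : ℂ) * (Complex.I ^ r / r.factorial)‖
      ≤ δ * ∑ r ∈ Finset.range R, (|u| * J₀.card) ^ r / r.factorial := by
    rw [← Finset.sum_sub_distrib, Finset.mul_sum]
    refine (norm_sum_le _ _).trans (Finset.sum_le_sum fun r hr => ?_)
    rw [← sub_mul, ← Complex.ofReal_sub, norm_mul, Complex.norm_real, Real.norm_eq_abs, norm_div, norm_pow,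
      Complex.norm_I, one_pow, Complex.norm_natCast]
    calc _ ≤ (|u| * J₀.card) ^ r * δ * (1 / r.factorial) :=
          mul_le_mul_of_nonneg_right (hmom r (Finset.mem_range.1 hr).le) (by positivity)
      _ = _ := by ring
  rw [Finset.sum_range_succ, mul_add]
  set PX := ∑ r ∈ Finset.range R, ((𝔼 x ∈ s, X x ^ r : ℝ) : ℂ) * (Complex.I ^ r / r.factorial)
  set PY := ∑ r ∈ Finset.range R, ((𝔼 A ∈ J₀.powerset, Y A ^ r : ℝ) : ℂ) * (Complex.I ^ r / r.factorial)
  have htri := norm_add₃_le (a := (𝔼 x ∈ s, Complex.exp (X x * Complex.I)) - PX) (b := PX - PY)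
    (c := PY - 𝔼 A ∈ J₀.powerset, Complex.exp (Y A * Complex.I))
  rw [norm_sub_rev PY] at htri
  simp only [sub_add_sub_cancel] at htri
  have : 4 / 2 ^ R * Real.exp (2 * u ^ 2 * J₀.card) = 2 / 2 ^ R * Real.exp (2 * u ^ 2 * J₀.card)
    + 2 / 2 ^ R * Real.exp (2 * u ^ 2 * J₀.card) := by ring
  linarith

end CharFun
theorem tendsto_cos_inv_sqrt_pow (t : ℝ) :
    Tendsto (fun n : ℕ => Real.cos (t / Real.sqrt n) ^ n) atTop (𝓝 (Real.exp (-t ^ 2 / 2))) := by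
  have h0 : (fun n : ℕ => Real.cos (t / Real.sqrt n) - (1 + (-t ^ 2 / 2) / n))
      =o[atTop] fun n : ℕ => 1 / (n : ℝ) := by
    have hb : (fun n : ℕ => Real.cos (t / Real.sqrt n) - (1 + (-t ^ 2 / 2) / n))
        =O[atTop] fun n : ℕ => 1 / (n : ℝ) * (1 / (n : ℝ)) := by
      refine IsBigO.of_bound (t ^ 4 * (5 / 96)) ?_
      have h1 : Tendsto (fun n : ℕ => t / Real.sqrt n) atTop (𝓝 0) :=
        (Real.tendsto_sqrt_atTop.comp tendsto_natCast_atTop_atTop).const_div_atTop t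
      have h2 : ∀ᶠ n : ℕ in atTop, |t / Real.sqrt n| ≤ 1 := by
        have := h1.abs
        rw [abs_zero] at this
        exact this.eventually_le_const one_pos
      filter_upwards [h2, eventually_gt_atTop 0] with n hn hn0
      have h3 := Real.cos_bound hn
      have hn0' : (0 : ℝ) < n := by exact_mod_cast hn0
      have h4 : (t / Real.sqrt n) ^ 2 = t ^ 2 / n := by rw [div_pow, Real.sq_sqrt hn0'.le]
      have h5 : |t / Real.sqrt n| ^ 4 = t ^ 4 * (1 / n * (1 / n)) := by
        rw [show |t / Real.sqrt n| ^ 4 = ((t / Real.sqrt n) ^ 2) ^ 2 by rw [← sq_abs (t / _)]; ring, h4]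
        ring
      rw [h4, h5] at h3
      rw [Real.norm_eq_abs, Real.norm_of_nonneg (by positivity)]
      calc |Real.cos (t / Real.sqrt n) - (1 + -t ^ 2 / 2 / n)|
          = |Real.cos (t / Real.sqrt n) - (1 - t ^ 2 / n / 2)| := by congr 1; ring
        _ ≤ _ := h3
        _ = _ := by ring
    refine hb.trans_isLittleO ?_
    have h1 : (fun n : ℕ => 1 / (n : ℝ)) =o[atTop] fun _ : ℕ => (1 : ℝ) :=
      (isLittleO_one_iff ℝ).2 tendsto_one_div_atTop_nhds_zero_nat
    simpa using h1.mul_isBigO (isBigO_refl (fun n : ℕ => 1 / (n : ℝ)) atTop)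
  have h1 : Tendsto (fun n : ℕ => (n : ℝ) * (Real.cos (t / Real.sqrt n) - 1)) atTop (𝓝 (-t ^ 2 / 2)) := by
    have h2 := h0.tendsto_inv_smul_nhds_zero.add_const (-t ^ 2 / 2)
    rw [zero_add] at h2
    refine h2.congr' ?_
    filter_upwards [eventually_gt_atTop 0] with n hn
    have hn' : (n : ℝ) ≠ 0 := by exact_mod_cast hn.ne'
    rw [smul_eq_mul]
    field_simp
    ring
  simpa using Real.tendsto_one_add_pow_exp_of_tendsto h1

section EmpiricalMeasure

open scoped BigOperators ENNReal

/-- The empirical law of `X` on a finite sample. -/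
def empiricalMeasure {α : Type*} (s : Finset α) (X : α → ℝ) : Measure ℝ :=
  (s.card : ℝ≥0∞)⁻¹ • ∑ m ∈ s, Measure.dirac (X m)

theorem isProbabilityMeasure_empiricalMeasure {α : Type*} {s : Finset α} (hs : s.Nonempty) (X : α → ℝ) :
    IsProbabilityMeasure (empiricalMeasure s X) := by
  constructor
  have h1 : (s.card : ℝ≥0∞) ≠ 0 := by simpa using hs.ne_empty
  simp [empiricalMeasure, ENNReal.inv_mul_cancel h1 (ENNReal.natCast_ne_top _)]

theorem charFun_empiricalMeasure {α : Type*} (s : Finset α) (X : α → ℝ) (t : ℝ) :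
    charFun (empiricalMeasure s X) t = 𝔼 m ∈ s, Complex.exp (((t * X m : ℝ) : ℂ) * Complex.I) := by
  rw [charFun_apply_real, empiricalMeasure, integral_smul_measure, integral_finsetSum_measure,
    Finset.expect_eq_sum_div_card]
  · simp [integral_dirac, div_eq_inv_mul]
  · intro m _
    exact integrable_dirac (by simp)

theorem empiricalMeasure_Iic {α : Type*} (s : Finset α) (X : α → ℝ) (lam : ℝ) :
    (empiricalMeasure s X (Set.Iic lam)).toReal = ((s.filter fun m => X m ≤ lam).card : ℝ) / s.card := by
  simp only [empiricalMeasure, Measure.smul_apply, Measure.finsetSum_apply, smul_eq_mul,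
    Measure.dirac_apply' _ measurableSet_Iic, ENNReal.toReal_mul, ENNReal.toReal_inv, ENNReal.toReal_natCast]
  rw [← div_eq_inv_mul]
  congr 1
  simp [Set.indicator_apply, Finset.sum_boole]

theorem gaussianReal_Iic (lam : ℝ) :
    (ProbabilityTheory.gaussianReal 0 1 (Set.Iic lam)).toReal = gaussLimit lam := by
  rw [ProbabilityTheory.gaussianReal_apply_eq_integral _ one_ne_zero, ENNReal.toReal_ofReal
    (integral_nonneg fun x => ProbabilityTheory.gaussianPDFReal_nonneg _ _ _), gaussLimit, ← integral_const_mul]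
  simp [ProbabilityTheory.gaussianPDFReal]

theorem tendsto_card_filter_le_div_card {α ι : Type*} {l : Filter ι} [l.IsCountablyGenerated]
    {s : ι → Finset α} (hs : ∀ i, (s i).Nonempty) {X : ι → α → ℝ}
    (hchar : ∀ t : ℝ, Tendsto (fun i => 𝔼 m ∈ s i, Complex.exp (((t * X i m : ℝ) : ℂ) * Complex.I)) l
      (𝓝 ((Real.exp (-t ^ 2 / 2) : ℝ) : ℂ))) (lam : ℝ) :
    Tendsto (fun i => (((s i).filter fun m => X i m ≤ lam).card : ℝ) / (s i).card) l
      (𝓝 (gaussLimit lam)) := by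
  refine tendsto_of_seq_tendsto fun u hu => ?_
  let μ : ℕ → ProbabilityMeasure ℝ := fun n =>
    ⟨empiricalMeasure (s (u n)) (X (u n)), isProbabilityMeasure_empiricalMeasure (hs _) _⟩
  let μ₀ : ProbabilityMeasure ℝ := ⟨ProbabilityTheory.gaussianReal 0 1, inferInstance⟩
  have hμ : Tendsto μ atTop (𝓝 μ₀) := by
    refine ProbabilityMeasure.tendsto_of_tendsto_charFun fun t => ?_
    have h1 : charFun (μ₀ : Measure ℝ) t = ((Real.exp (-t ^ 2 / 2) : ℝ) : ℂ) := by
      simp [μ₀, ProbabilityTheory.charFun_gaussianReal, neg_div]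
    rw [h1]
    refine ((hchar t).comp hu).congr fun n => ?_
    exact (charFun_empiricalMeasure _ _ _).symm
  have hnull : (μ₀ : Measure ℝ) (frontier (Set.Iic lam)) = 0 := by
    have := ProbabilityTheory.nullSingletonClass_gaussianReal (μ := 0) (v := 1) one_ne_zero
    rw [frontier_Iic]
    exact measure_singleton (μ := ProbabilityTheory.gaussianReal 0 1) lam
  have h2 := ProbabilityMeasure.tendsto_measure_of_null_frontier_of_tendsto' hμ hnull
  have h3 := (ENNReal.tendsto_toReal (measure_ne_top _ _)).comp h2
  rw [← gaussianReal_Iic]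
  exact h3.congr fun n => empiricalMeasure_Iic _ _ _

end EmpiricalMeasure
theorem jacobiSym_shiftProd (J : Finset ℕ) (m q : ℕ) :
    jacobiSym (shiftProd J m) q = ∏ j ∈ J, jacobiSym ((m : ℤ) + j) q := by
  unfold shiftProd
  induction J using Finset.induction_on with
  | empty => simp
  | insert i J hi ih =>
    rw [Finset.prod_insert hi, Finset.prod_insert hi, ← ih]
    push_cast
    rw [jacobiSym.mul_left]

theorem jacobiSym_add_sq_eq_one {q m j : ℕ} (hq : q.Prime) (hm : 1 ≤ m) (hlt : m + j < q) :
    ((jacobiSym ((m : ℤ) + j) q : ℤ) : ℝ) ^ 2 = 1 := by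
  have h1 : Int.gcd ((m : ℤ) + j) q = 1 := by
    rw [← Nat.cast_add, Int.gcd_natCast_natCast]
    exact ((Nat.Prime.coprime_iff_not_dvd hq).2 (Nat.not_dvd_of_pos_of_lt (by omega) hlt)).symm
  exact_mod_cast jacobiSym.sq_one h1

section Assembly

open scoped BigOperators

theorem abs_expect_prod_jacobiSym_le {g : ℝ → ℝ} {q h R : ℕ} (hg2 : 2 ≤ g q) (hh : 1 ≤ h)
    (hhR : (h : ℝ) ^ (400 * R) ≤ g q) (hcor : ∀ k, 1 ≤ k → k ≤ R → q.Prime ∧ q ∉ correlatedPrimes g k)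
    {J : Finset ℕ} (hJ : J ⊆ Finset.Icc 1 h) (hne : J.Nonempty) (hJR : J.card ≤ R) :
    |𝔼 m ∈ Finset.Icc 1 ⌊g q⌋₊, ∏ j ∈ J, ((jacobiSym ((m : ℤ) + j) q : ℤ) : ℝ)|
      ≤ 2 * g q ^ (-0.005 : ℝ) := by
  have hg0 : 0 < g q := by linarith
  have hfloor : g q / 2 ≤ ⌊g q⌋₊ := by
    have := Nat.lt_floor_add_one (g q)
    linarith
  obtain ⟨hq, hmem⟩ := hcor J.card hne.card_pos hJR
  have hsum : |∑ m ∈ Finset.Icc 1 ⌊g q⌋₊, (jacobiSym (shiftProd J m) q : ℝ)| ≤ g q ^ (0.995 : ℝ) := by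
    by_contra hlt
    refine hmem ⟨hq, J, rfl, fun j hj => ?_, not_le.1 hlt⟩
    have hj1 := Finset.mem_Icc.1 (hJ hj)
    refine le_trans ?_ hhR
    calc (j : ℝ) ^ (100 * J.card) ≤ (h : ℝ) ^ (100 * J.card) := by
          have : (j : ℝ) ≤ h := by exact_mod_cast hj1.2
          gcongr
      _ ≤ (h : ℝ) ^ (400 * R) := pow_le_pow_right₀ (by exact_mod_cast hh) (by omega)
  have heq : ∀ m ∈ Finset.Icc 1 ⌊g q⌋₊, ∏ j ∈ J, ((jacobiSym ((m : ℤ) + j) q : ℤ) : ℝ)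
      = (jacobiSym (shiftProd J m) q : ℝ) := by
    intro m _
    rw [jacobiSym_shiftProd]
    push_cast
    rfl
  rw [Finset.expect_congr rfl heq, Finset.expect_eq_sum_div_card, Nat.card_Icc, Nat.add_sub_cancel, abs_div,
    Nat.abs_cast]
  calc _ ≤ g q ^ (0.995 : ℝ) / (g q / 2) := by gcongr
    _ = 2 * (g q ^ (0.995 : ℝ) / g q ^ (1 : ℝ)) := by rw [Real.rpow_one]; field_simp
    _ = _ := by rw [← Real.rpow_sub hg0]; norm_num

theorem norm_expect_cexp_jacobiSym_sub_le {g : ℝ → ℝ} {q h R : ℕ} (hq : q.Prime) (hg2 : 2 ≤ g q)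
    (hlt : g q + h < q) (hh : 1 ≤ h) (hR : Even R) (hhR : (h : ℝ) ^ (400 * R) ≤ g q)
    (hcor : ∀ k, 1 ≤ k → k ≤ R → q ∉ correlatedPrimes g k) (t : ℝ) :
    ‖(𝔼 m ∈ Finset.Icc 1 ⌊g q⌋₊, Complex.exp (((t / Real.sqrt h *
        ∑ j ∈ Finset.Icc 1 h, ((jacobiSym ((m : ℤ) + j) q : ℤ) : ℝ) : ℝ) : ℂ) * Complex.I))
        - ((Real.cos (t / Real.sqrt h) ^ h : ℝ) : ℂ)‖
      ≤ 2 * Real.exp |t| * g q ^ (-0.0025 : ℝ) + 4 / 2 ^ R * Real.exp (2 * t ^ 2) := by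
  have hg0 : 0 < g q := by linarith
  have hh0 : (0 : ℝ) < h := by exact_mod_cast hh
  have hh1 : (1 : ℝ) ≤ h := by exact_mod_cast hh
  have hne : (Finset.Icc 1 ⌊g q⌋₊).Nonempty :=
    ⟨1, Finset.mem_Icc.2 ⟨le_rfl, Nat.le_floor (by push_cast; linarith)⟩⟩
  have hsq : ∀ m ∈ Finset.Icc 1 ⌊g q⌋₊, ∀ j ∈ Finset.Icc 1 h,
      ((jacobiSym ((m : ℤ) + j) q : ℤ) : ℝ) ^ 2 = 1 := by
    intro m hm j hj
    have hm := Finset.mem_Icc.1 hm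
    have hj := Finset.mem_Icc.1 hj
    refine jacobiSym_add_sq_eq_one hq hm.1 ?_
    have h1 : (m : ℝ) ≤ g q := (Nat.le_floor_iff hg0.le).1 hm.2
    have h2 : (j : ℝ) ≤ h := by exact_mod_cast hj.2
    have h3 : (m : ℝ) + j < q := by linarith
    exact_mod_cast h3
  have hmain := norm_expect_cexp_sub_cos_pow_le (δ := 2 * g q ^ (-0.005 : ℝ)) hne hsq hR (by positivity)
    (fun J hJ hJne hJR => abs_expect_prod_jacobiSym_le hg2 hh hhR (fun k h1 h2 => ⟨hq, hcor k h1 h2⟩) hJ hJne hJR)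
    (t / Real.sqrt h)
  rw [Nat.card_Icc, Nat.add_sub_cancel] at hmain
  refine hmain.trans (add_le_add ?_ (le_of_eq ?_))
  · have hsum : ∑ r ∈ Finset.range (R + 1), (|t / Real.sqrt h| * h) ^ r / r.factorial
        ≤ (h : ℝ) ^ R * Real.exp |t| := by
      refine le_trans ?_ (mul_le_mul_of_nonneg_left (Real.sum_le_exp_of_nonneg (abs_nonneg t) (R + 1))
        (by positivity))
      rw [Finset.mul_sum]
      refine Finset.sum_le_sum fun r hr => ?_
      have hrR : r ≤ R := Nat.lt_succ_iff.1 (Finset.mem_range.1 hr)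
      have h1 : |t / Real.sqrt h| ≤ |t| := by
        rw [abs_div, abs_of_nonneg (Real.sqrt_nonneg _)]
        exact div_le_self (abs_nonneg _) (Real.one_le_sqrt.2 hh1)
      calc (|t / Real.sqrt h| * h) ^ r / r.factorial ≤ (|t| * h) ^ r / r.factorial := by gcongr
        _ = (h : ℝ) ^ r * (|t| ^ r / r.factorial) := by ring
        _ ≤ (h : ℝ) ^ R * (|t| ^ r / r.factorial) := by
            gcongr
    have hhg : (h : ℝ) ^ R ≤ g q ^ (0.0025 : ℝ) := by
      calc (h : ℝ) ^ R = ((h : ℝ) ^ (400 * R)) ^ (0.0025 : ℝ) := by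
            rw [← Real.rpow_natCast, ← Real.rpow_natCast, ← Real.rpow_mul hh0.le]
            congr 1
            push_cast
            ring
        _ ≤ _ := by gcongr
    have hpow : g q ^ (-0.005 : ℝ) * g q ^ (0.0025 : ℝ) = g q ^ (-0.0025 : ℝ) := by
      rw [← Real.rpow_add hg0]; norm_num
    calc _ ≤ 2 * g q ^ (-0.005 : ℝ) * (g q ^ (0.0025 : ℝ) * Real.exp |t|) := by
          refine mul_le_mul_of_nonneg_left (hsum.trans ?_) (by positivity)
          gcongr
      _ = 2 * Real.exp |t| * (g q ^ (-0.005 : ℝ) * g q ^ (0.0025 : ℝ)) := by ring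
      _ = _ := by rw [hpow]
  · congr 2
    rw [div_pow, Real.sq_sqrt hh0.le]
    field_simp

theorem S_natCast (h m q : ℕ) :
    (S h (m : ℝ) q : ℝ) = ∑ j ∈ Finset.Icc 1 h, ((jacobiSym ((m : ℤ) + j) q : ℤ) : ℝ) := by
  simp [S]

theorem M_eq_card_filter {g : ℝ → ℝ} {q h : ℕ} (hg : 1 ≤ g q) (hh : 1 ≤ h) (lam : ℝ) :
    M g q h lam = ((⌊g q⌋₊ : ℝ) / g q) * ((((Finset.Icc 1 ⌊g q⌋₊).filter fun m : ℕ =>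
      (∑ j ∈ Finset.Icc 1 h, ((jacobiSym ((m : ℤ) + j) q : ℤ) : ℝ)) / Real.sqrt h ≤ lam).card : ℝ)
        / (Finset.Icc 1 ⌊g q⌋₊).card) := by
  have hsqrt : 0 < Real.sqrt h := Real.sqrt_pos.2 (by exact_mod_cast hh)
  have hset : {m : ℤ | 1 ≤ (m : ℝ) ∧ (m : ℝ) ≤ g q ∧ (S h (m : ℝ) q : ℝ) ≤ lam * Real.sqrt h}
      = (Nat.cast : ℕ → ℤ) '' ((Finset.Icc 1 ⌊g q⌋₊).filter fun m : ℕ =>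
        (∑ j ∈ Finset.Icc 1 h, ((jacobiSym ((m : ℤ) + j) q : ℤ) : ℝ)) / Real.sqrt h ≤ lam : Finset ℕ) := by
    ext m
    simp only [Set.mem_ofPred_eq, Set.mem_image, Finset.coe_filter, Finset.mem_Icc, div_le_iff₀ hsqrt]
    constructor
    · rintro ⟨h1, h2, h3⟩
      have h4 : 1 ≤ m := by exact_mod_cast h1
      lift m to ℕ using by omega
      rw [Int.cast_natCast] at h2 h3
      rw [S_natCast] at h3
      exact ⟨m, ⟨⟨by omega, Nat.le_floor h2⟩, h3⟩, rfl⟩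
    · rintro ⟨n, ⟨⟨h1, h2⟩, h3⟩, rfl⟩
      rw [Int.cast_natCast, S_natCast]
      exact ⟨by exact_mod_cast h1, (Nat.le_floor_iff (by linarith)).1 h2, h3⟩
  have hfl : (⌊g q⌋₊ : ℝ) ≠ 0 := by
    have : 1 ≤ ⌊g q⌋₊ := Nat.le_floor (by push_cast; linarith)
    positivity
  rw [M, hset, Set.ncard_image_of_injective _ Nat.cast_injective, Set.ncard_coe_finset, Nat.card_Icc,
    Nat.add_sub_cancel]
  field_simp

end Assembly

section Convergence

open scoped BigOperators

variable {g : ℝ → ℝ} {h : ℕ → ℕ} {l : Filter ℕ}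

theorem eventually_pow_le_of_log_div_log {u v : ℕ → ℝ} (hu : ∀ᶠ q in l, 1 ≤ u q) (hv : Tendsto v l atTop)
    (huv : Tendsto (fun q => Real.log (u q) / Real.log (v q)) l (𝓝 0)) (K : ℕ) :
    ∀ᶠ q in l, u q ^ K ≤ v q := by
  filter_upwards [hu, hv.eventually_gt_atTop 1,
    huv.eventually_lt_const (by positivity : (0 : ℝ) < 1 / (K + 1))] with q h1 h2 h3
  have hlog : 0 < Real.log (v q) := Real.log_pos h2
  have hlogu : 0 ≤ Real.log (u q) := Real.log_nonneg h1
  rw [div_lt_div_iff₀ hlog (by positivity), one_mul] at h3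
  rw [← Real.log_le_log_iff (by positivity) (by linarith), Real.log_pow]
  nlinarith

theorem eventually_two_mul_lt_self (hslow : ∀ ε : ℝ, 0 < ε → (fun Q : ℝ => g Q) =O[atTop] fun Q : ℝ => Q ^ ε) :
    ∀ᶠ Q in atTop, 2 * g Q < Q := by
  obtain ⟨c, hc⟩ := (hslow (1 / 2) (by norm_num)).bound
  filter_upwards [hc, eventually_gt_atTop 0,
    (tendsto_rpow_atTop (by norm_num : (0 : ℝ) < 1 / 2)).eventually_gt_atTop (2 * c)] with Q hQ hpos hroot
  rw [Real.norm_of_nonneg (Real.rpow_nonneg hpos.le _)] at hQ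
  have hsq : Q ^ (1 / 2 : ℝ) * Q ^ (1 / 2 : ℝ) = Q := by
    rw [← Real.rpow_add hpos]
    norm_num
  have hrpos : 0 < Q ^ (1 / 2 : ℝ) := by positivity
  have := (Real.le_norm_self (g Q)).trans hQ
  nlinarith

theorem tendsto_expect_cexp_jacobiSym
    (hslow : ∀ ε : ℝ, 0 < ε → (fun Q : ℝ => g Q) =O[atTop] fun Q : ℝ => Q ^ ε)
    (hl : Tendsto (fun q : ℕ => (q : ℝ)) l atTop) (hprime : ∀ᶠ q in l, q.Prime)
    (hg : Tendsto (fun q : ℕ => g q) l atTop) (hinf : Tendsto h l atTop)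
    (hsmall : Tendsto (fun q : ℕ => Real.log (h q) / Real.log (g q)) l (𝓝 0))
    (hcor : ∀ k, 1 ≤ k → ∀ᶠ q in l, q ∉ correlatedPrimes g k) (t : ℝ) :
    Tendsto (fun q : ℕ => 𝔼 m ∈ Finset.Icc 1 ⌊g q⌋₊, Complex.exp (((t / Real.sqrt (h q) *
        ∑ j ∈ Finset.Icc 1 (h q), ((jacobiSym ((m : ℤ) + j) q : ℤ) : ℝ) : ℝ) : ℂ) * Complex.I))
      l (𝓝 ((Real.exp (-t ^ 2 / 2) : ℝ) : ℂ)) := by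
  have hcos : Tendsto (fun q => ((Real.cos (t / Real.sqrt (h q)) ^ h q : ℝ) : ℂ)) l
      (𝓝 ((Real.exp (-t ^ 2 / 2) : ℝ) : ℂ)) :=
    (Complex.continuous_ofReal.tendsto _).comp ((tendsto_cos_inv_sqrt_pow t).comp hinf)
  have hh1 : ∀ᶠ q in l, (1 : ℝ) ≤ h q := by
    filter_upwards [hinf.eventually_ge_atTop 1] with q hq
    exact_mod_cast hq
  suffices hdiff : Tendsto (fun q : ℕ => (𝔼 m ∈ Finset.Icc 1 ⌊g q⌋₊, Complex.exp (((t / Real.sqrt (h q) *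
        ∑ j ∈ Finset.Icc 1 (h q), ((jacobiSym ((m : ℤ) + j) q : ℤ) : ℝ) : ℝ) : ℂ) * Complex.I))
        - ((Real.cos (t / Real.sqrt (h q)) ^ h q : ℝ) : ℂ)) l (𝓝 0) by
    simpa using hdiff.add hcos
  rw [Metric.tendsto_nhds]
  intro ε hε
  have hpow : Tendsto (fun R : ℕ => 4 / 2 ^ (2 * R) * Real.exp (2 * t ^ 2)) atTop (𝓝 0) := by
    have : Tendsto (fun R : ℕ => 4 * Real.exp (2 * t ^ 2) * (1 / 4 : ℝ) ^ R) atTop (𝓝 0) := by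
      simpa using (tendsto_pow_atTop_nhds_zero_of_lt_one (by norm_num : (0 : ℝ) ≤ 1 / 4)
        (by norm_num)).const_mul (4 * Real.exp (2 * t ^ 2))
    refine this.congr fun R => ?_
    rw [pow_mul, div_pow, one_pow]
    norm_num
    ring
  obtain ⟨R, hR⟩ := (hpow.eventually_lt_const (half_pos hε)).exists
  have hsmallterm : Tendsto (fun q : ℕ => 2 * Real.exp |t| * g q ^ (-0.0025 : ℝ)) l (𝓝 0) := by
    simpa using ((tendsto_rpow_neg_atTop (by norm_num : (0 : ℝ) < 0.0025)).comp hg).const_mul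
      (2 * Real.exp |t|)
  have hcorR : ∀ᶠ q in l, ∀ k ∈ Finset.Icc 1 (2 * R), q ∉ correlatedPrimes g k :=
    (Filter.eventually_all_finset _).2 fun k hk => hcor k (Finset.mem_Icc.1 hk).1
  filter_upwards [hprime, hg.eventually_ge_atTop 2, hh1, hl.eventually (eventually_two_mul_lt_self hslow),
    eventually_pow_le_of_log_div_log hh1 hg hsmall 1,
    eventually_pow_le_of_log_div_log hh1 hg hsmall (400 * (2 * R)), hcorR,
    hsmallterm.eventually_lt_const (half_pos hε)] with q hq hg2 hh hlt hle hleR hk hterm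
  rw [pow_one] at hle
  rw [dist_zero_right]
  refine (norm_expect_cexp_jacobiSym_sub_le hq hg2 (by linarith) (by exact_mod_cast hh)
    (even_two_mul R) hleR (fun k h1 h2 => hk k (Finset.mem_Icc.2 ⟨h1, h2⟩)) t).trans_lt ?_
  linarith

theorem tendsto_M_gaussLimit [l.IsCountablyGenerated]
    (hslow : ∀ ε : ℝ, 0 < ε → (fun Q : ℝ => g Q) =O[atTop] fun Q : ℝ => Q ^ ε)
    (hl : Tendsto (fun q : ℕ => (q : ℝ)) l atTop) (hprime : ∀ᶠ q in l, q.Prime)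
    (hg : Tendsto (fun q : ℕ => g q) l atTop) (hinf : Tendsto h l atTop)
    (hsmall : Tendsto (fun q : ℕ => Real.log (h q) / Real.log (g q)) l (𝓝 0))
    (hcor : ∀ k, 1 ≤ k → ∀ᶠ q in l, q ∉ correlatedPrimes g k) (lam : ℝ) :
    Tendsto (fun q : ℕ => M g q (h q) lam) l (𝓝 (gaussLimit lam)) := by
  have hfloor : ∀ᶠ q : ℕ in l, max 1 ⌊g q⌋₊ = ⌊g q⌋₊ := by
    filter_upwards [hg.eventually_ge_atTop 1] with q hq
    exact max_eq_right (Nat.le_floor (by simpa using hq))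
  have hcard := tendsto_card_filter_le_div_card (l := l) (s := fun q : ℕ => Finset.Icc 1 (max 1 ⌊g q⌋₊))
    (fun q => ⟨1, by simp⟩)
    (X := fun q m => (∑ j ∈ Finset.Icc 1 (h q), ((jacobiSym ((m : ℤ) + j) q : ℤ) : ℝ)) / Real.sqrt (h q))
    (fun t => by
      refine (tendsto_expect_cexp_jacobiSym hslow hl hprime hg hinf hsmall hcor t).congr' ?_
      filter_upwards [hfloor] with q hq
      rw [hq]
      refine Finset.expect_congr rfl fun m _ => ?_
      rw [div_mul_eq_mul_div, mul_div_assoc]) lam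
  have hratio : Tendsto (fun q : ℕ => (⌊g q⌋₊ : ℝ) / g q) l (𝓝 1) :=
    (tendsto_nat_floor_div_atTop (R := ℝ)).comp hg
  have hmul := hratio.mul hcard
  rw [one_mul] at hmul
  refine hmul.congr' ?_
  filter_upwards [hfloor, hg.eventually_ge_atTop 1, hinf.eventually_ge_atTop 1] with q hq hg1 hh
  rw [M_eq_card_filter hg1 hh, hq]

end Convergence

theorem stmt0 (g : ℝ → ℝ) (hmono : StrictMono g) (hdiff : Differentiable ℝ g)
    (hdiv : Tendsto g atTop atTop)
    (hderiv : ∃ C > 0, ∀ᶠ Q : ℝ in atTop, ∀ c ∈ Set.Icc Q (Q + Q ^ (0.01 : ℝ)),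
      |deriv g c| ≤ C * g Q ^ (0.99 : ℝ) * Q ^ (-0.01 : ℝ))
    (hslow : ∀ ε : ℝ, 0 < ε → (fun Q : ℝ => g Q) =O[atTop] fun Q : ℝ => Q ^ ε)
    (h : ℕ → ℕ)
    (hinf : Tendsto h (atTop ⊓ 𝓟 {p : ℕ | p.Prime}) atTop)
    (hsmall : Tendsto (fun q : ℕ => Real.log (h q) / Real.log (g q))
      (atTop ⊓ 𝓟 {p : ℕ | p.Prime}) (𝓝 0)) :
    ∃ B : Set ℕ, B ⊆ {p : ℕ | p.Prime} ∧
      (∀ η ∈ Set.Icc (0.01 : ℝ) 1, EtaSufficient η B) ∧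
      ∀ lam : ℝ, Tendsto (fun q : ℕ => M g q (h q) lam) (atTop ⊓ 𝓟 B)
        (𝓝 (gaussLimit lam)) := by
  obtain ⟨B, hB, hsuff, hcor⟩ := exists_sufficient_set hmono hdiff hdiv hderiv hslow
  refine ⟨B, hB, hsuff, fun lam => ?_⟩
  have hle : atTop ⊓ 𝓟 B ≤ atTop ⊓ 𝓟 {p : ℕ | p.Prime} := inf_le_inf_left _ (principal_mono.2 hB)
  have hcast : Tendsto (fun q : ℕ => (q : ℝ)) (atTop ⊓ 𝓟 B) atTop :=
    tendsto_natCast_atTop_atTop.mono_left inf_le_left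
  have hmem : ∀ᶠ q in atTop ⊓ 𝓟 B, q ∈ B := mem_inf_of_right (mem_principal_self B)
  refine tendsto_M_gaussLimit hslow hcast (hmem.mono fun q hq => hB hq) (hdiv.comp hcast)
    (hinf.mono_left hle) (hsmall.mono_left hle) (fun k hk => ?_) lam
  obtain ⟨N, hN⟩ := hcor k hk
  filter_upwards [hmem, mem_inf_of_left (eventually_ge_atTop N)] with q hq hNq
  exact hN q hq hNq
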